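/- For every n there exists a triangle-free graph on n vertices whose clique chromatic number is Ω(√(n/log n)); consequently, the O(√(n/log n)) upper bound for the clique chromatic number of n-vertex graphs is tight up to a constant factor. -/

import Mathlib

open SimpleGraph

/-- A maximal clique of a simple graph: a clique not properly contained in another clique. -/
def MaxClique {V : Type*} (G : SimpleGraph V) (s : Set V) : Prop :=
  G.IsClique s ∧ ∀ t : Set V, G.IsClique t → s ⊆ t → t = s

/-- A clique colouring: no inclusion-wise maximal clique with at least two vertices
is monochromatic. -/
def CliqueColoring {V α : Type*} (G : SimpleGraph V) (c : V → α) : Prop :=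
  ∀ s : Set V, MaxClique G s → (∃ x ∈ s, ∃ y ∈ s, x ≠ y) →
    ¬ ∃ a : α, ∀ x ∈ s, c x = a

/-- The clique chromatic number: least number of colours in a clique colouring. -/
noncomputable def cliqueChromaticNumber {V : Type*} (G : SimpleGraph V) : ℕ :=
  sInf {n : ℕ | ∃ c : V → Fin n, CliqueColoring G c}


noncomputable section

/-- expectation over a finite product space -/
def Ex {ι R : Type} [Fintype ι] [DecidableEq ι] [Fintype R] (μ : R → ℝ) (f : (ι → R) → ℝ) : ℝ :=
  ∑ ω : ι → R, (∏ i, μ (ω i)) * f ω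

section ExBasics
variable {ι R : Type} [Fintype ι] [DecidableEq ι] [Fintype R] (μ : R → ℝ)

lemma Ex_prod (g : ι → R → ℝ) :
    Ex μ (fun ω : ι → R => ∏ i, g i (ω i)) = ∏ i, ∑ r, μ r * g i r := by
  unfold Ex
  rw [Finset.prod_univ_sum]
  rw [Fintype.piFinset_univ]
  refine Finset.sum_congr rfl fun ω _ => ?_
  rw [Finset.prod_mul_distrib]

lemma Ex_const (h1 : ∑ r, μ r = 1) (c : ℝ) : Ex μ (fun _ : ι → R => c) = c := by
  have := Ex_prod (ι := ι) μ (fun _ _ => 1)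
  unfold Ex at *
  simp only [Finset.prod_const_one, mul_one, h1] at this
  rw [← Finset.sum_mul, this, one_mul]

lemma Ex_mono (h0 : ∀ r, 0 ≤ μ r) {f g : (ι → R) → ℝ} (h : ∀ ω, f ω ≤ g ω) : Ex μ f ≤ Ex μ g := by
  unfold Ex
  exact Finset.sum_le_sum fun ω _ =>
    mul_le_mul_of_nonneg_left (h ω) (Finset.prod_nonneg fun i _ => h0 _)

lemma Ex_nonneg (h0 : ∀ r, 0 ≤ μ r) {f : (ι → R) → ℝ} (h : ∀ ω, 0 ≤ f ω) : 0 ≤ Ex μ f := by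
  unfold Ex
  exact Finset.sum_nonneg fun ω _ => mul_nonneg (Finset.prod_nonneg fun i _ => h0 _) (h ω)

lemma Ex_add (f g : (ι → R) → ℝ) : Ex μ (fun ω => f ω + g ω) = Ex μ f + Ex μ g := by
  unfold Ex
  rw [← Finset.sum_add_distrib]
  exact Finset.sum_congr rfl fun ω _ => by ring

lemma Ex_smul (c : ℝ) (f : (ι → R) → ℝ) : Ex μ (fun ω => c * f ω) = c * Ex μ f := by
  unfold Ex
  rw [Finset.mul_sum]
  exact Finset.sum_congr rfl fun ω _ => by ring

lemma Ex_sum {κ : Type*} (s : Finset κ) (f : κ → (ι → R) → ℝ) :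
    Ex μ (fun ω => ∑ k ∈ s, f k ω) = ∑ k ∈ s, Ex μ (f k) := by
  unfold Ex
  rw [Finset.sum_comm]
  exact Finset.sum_congr rfl fun ω _ => by rw [Finset.mul_sum]

lemma Ex_exists_lt (h0 : ∀ r, 0 ≤ μ r) (h1 : ∑ r, μ r = 1) {f : (ι → R) → ℝ} {c : ℝ}
    (h : Ex μ f < c) : ∃ ω, f ω < c := by
  by_contra! hc
  have := Ex_mono μ h0 hc
  rw [Ex_const μ h1] at this
  linarith

lemma Ex_avg (h1 : ∑ r, μ r = 1) (j : ι) (f : (ι → R) → ℝ) :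
    Ex μ f = Ex μ (fun ω => ∑ r, μ r * f (Function.update ω j r)) := by
  unfold Ex
  let e : (ι → R) × R ≃ (ι → R) × R :=
    { toFun := fun x => (Function.update x.1 j x.2, x.1 j)
      invFun := fun x => (Function.update x.1 j x.2, x.1 j)
      left_inv := fun x => by simp
      right_inv := fun x => by simp }
  have hw : ∀ (ω : ι → R) (r : R),
      (∏ i, μ (Function.update ω j r i)) * μ (ω j) = (∏ i, μ (ω i)) * μ r := by
    intro ω r
    rw [← Finset.mul_prod_erase Finset.univ _ (Finset.mem_univ j),
      ← Finset.mul_prod_erase Finset.univ (fun i => μ (ω i)) (Finset.mem_univ j)]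
    have : ∏ x ∈ Finset.univ.erase j, μ (Function.update ω j r x)
        = ∏ x ∈ Finset.univ.erase j, μ (ω x) := by
      refine Finset.prod_congr rfl fun x hx => ?_
      rw [Function.update_of_ne (Finset.ne_of_mem_erase hx)]
    rw [this]
    simp only [Function.update_self]
    ring
  have e1 : ∑ ω : ι → R, (∏ i, μ (ω i)) * f ω
      = ∑ x : (ι → R) × R, ((∏ i, μ (x.1 i)) * μ x.2) * f x.1 := by
    rw [Fintype.sum_prod_type]
    refine Finset.sum_congr rfl fun ω _ => ?_
    simp only
    rw [← Finset.sum_mul, ← Finset.mul_sum, h1, mul_one]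
  have e2 : ∑ ω : ι → R, (∏ i, μ (ω i)) * ∑ r, μ r * f (Function.update ω j r)
      = ∑ x : (ι → R) × R, ((∏ i, μ (x.1 i)) * μ x.2) * f (Function.update x.1 j x.2) := by
    rw [Fintype.sum_prod_type]
    refine Finset.sum_congr rfl fun ω _ => ?_
    simp only
    rw [Finset.mul_sum]
    exact Finset.sum_congr rfl fun r _ => by ring
  rw [e1, e2, ← Equiv.sum_comp e]
  refine Finset.sum_congr rfl fun x _ => ?_
  simp only [e, Equiv.coe_fn_mk]
  rw [hw]

lemma Ex_super (h0 : ∀ r, 0 ≤ μ r) (h1 : ∑ r, μ r = 1) (rk : ι → ℕ) (g : ι → (ι → R) → ℝ)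
    (g0 : ∀ e ω, 0 ≤ g e ω)
    (hdep : ∀ e f, f ≠ e → rk e ≤ rk f → ∀ ω r, g e (Function.update ω f r) = g e ω)
    (havg : ∀ e ω, ∑ r, μ r * g e (Function.update ω e r) ≤ 1) (s : Finset ι) :
    Ex μ (fun ω => ∏ e ∈ s, g e ω) ≤ 1 := by
  induction s using Finset.induction_on_max_value rk with
  | empty => simp [Ex_const μ h1]
  | insert a s has hmax ih =>
    rw [Ex_avg μ h1 a]
    refine le_trans (Ex_mono μ h0 fun ω => ?_) ih
    have : ∀ r, ∏ e ∈ insert a s, g e (Function.update ω a r)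
        = g a (Function.update ω a r) * ∏ e ∈ s, g e ω := by
      intro r
      rw [Finset.prod_insert has]
      congr 1
      refine Finset.prod_congr rfl fun x hx => ?_
      exact hdep x a (fun h => has (h ▸ hx)) (hmax x hx) ω r
    simp only [this, ← mul_assoc]
    rw [← Finset.sum_mul]
    exact mul_le_of_le_one_left (Finset.prod_nonneg fun e _ => g0 e ω) (havg a ω)

open Classical in
/-- probability -/
def Pr (P : (ι → R) → Prop) : ℝ := Ex μ (fun ω => if P ω then 1 else 0)

lemma Pr_mono (h0 : ∀ r, 0 ≤ μ r) {P Q : (ι → R) → Prop} (h : ∀ ω, P ω → Q ω) :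
    Pr μ P ≤ Pr μ Q := by
  unfold Pr
  refine Ex_mono μ h0 fun ω => ?_
  by_cases hP : P ω
  · simp [hP, h ω hP]
  · simp only [hP, if_false]; split_ifs <;> norm_num

lemma Pr_or (h0 : ∀ r, 0 ≤ μ r) (P Q : (ι → R) → Prop) :
    Pr μ (fun ω => P ω ∨ Q ω) ≤ Pr μ P + Pr μ Q := by
  unfold Pr
  rw [← Ex_add]
  refine Ex_mono μ h0 fun ω => ?_
  by_cases hP : P ω <;> by_cases hQ : Q ω <;> simp [hP, hQ]

lemma Pr_union (h0 : ∀ r, 0 ≤ μ r) {κ : Type*} (s : Finset κ) (P : κ → (ι → R) → Prop) :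
    Pr μ (fun ω => ∃ k ∈ s, P k ω) ≤ ∑ k ∈ s, Pr μ (P k) := by
  classical
  unfold Pr
  rw [← Ex_sum]
  refine Ex_mono μ h0 fun ω => ?_
  by_cases h : ∃ k ∈ s, P k ω
  · obtain ⟨k, hk, hP⟩ := h
    rw [if_pos ⟨k, hk, hP⟩]
    refine le_trans ?_ (Finset.single_le_sum (f := fun k => if P k ω then (1 : ℝ) else 0)
      (fun i _ => by positivity) hk)
    simp [hP]
  · rw [if_neg h]
    exact Finset.sum_nonneg fun i _ => by positivity

lemma Pr_union_le (h0 : ∀ r, 0 ≤ μ r) {κ : Type*} (s : Finset κ) (P : κ → (ι → R) → Prop)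
    (b : ℝ) (hb : ∀ k ∈ s, Pr μ (P k) ≤ b) :
    Pr μ (fun ω => ∃ k ∈ s, P k ω) ≤ s.card * b := by
  refine (Pr_union μ h0 s P).trans ?_
  rw [← nsmul_eq_mul]
  exact Finset.sum_le_card_nsmul _ _ _ hb

lemma Pr_markov (h0 : ∀ r, 0 ≤ μ r) (P : (ι → R) → Prop) (f : (ι → R) → ℝ) (c : ℝ) (hc : 0 < c)
    (f0 : ∀ ω, 0 ≤ f ω) (h : ∀ ω, P ω → c ≤ f ω) : Pr μ P ≤ Ex μ f / c := by
  rw [le_div_iff₀ hc, mul_comm]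
  unfold Pr
  rw [← Ex_smul]
  refine Ex_mono μ h0 fun ω => ?_
  by_cases hP : P ω
  · simpa [hP] using h ω hP
  · simpa [hP] using f0 ω

lemma Pr_exists (h0 : ∀ r, 0 ≤ μ r) (h1 : ∑ r, μ r = 1) {P : (ι → R) → Prop}
    (h : Pr μ P < 1) : ∃ ω, ¬ P ω := by
  obtain ⟨ω, hω⟩ := Ex_exists_lt μ h0 h1 h
  refine ⟨ω, fun hP => ?_⟩
  simp [hP] at hω

/-- probability that all coordinates in `T` lie in `A`. -/
lemma Pr_all [DecidableEq R] (h1 : ∑ r, μ r = 1) (T : Finset ι) (A : Finset R) :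
    Pr μ (fun ω => ∀ i ∈ T, ω i ∈ A) = (∑ r ∈ A, μ r) ^ T.card := by
  classical
  have : Pr μ (fun ω => ∀ i ∈ T, ω i ∈ A) =
      Ex μ (fun ω => ∏ i, (if i ∈ T then (if ω i ∈ A then (1:ℝ) else 0) else 1)) := by
    unfold Pr
    congr 1
    funext ω
    by_cases h : ∀ i ∈ T, ω i ∈ A
    · rw [if_pos h]
      symm
      refine Finset.prod_eq_one fun i _ => ?_
      by_cases hi : i ∈ T
      · simp [hi, h i hi]
      · simp [hi]
    · rw [if_neg h]
      push Not at h
      obtain ⟨i, hi, hA⟩ := h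
      symm
      exact Finset.prod_eq_zero (Finset.mem_univ i) (by simp [hi, hA])
  rw [this, Ex_prod μ (fun i r => if i ∈ T then (if r ∈ A then (1:ℝ) else 0) else 1)]
  have h2 : ∀ i, ∑ r, μ r * (if i ∈ T then (if r ∈ A then (1:ℝ) else 0) else 1)
      = if i ∈ T then ∑ r ∈ A, μ r else 1 := by
    intro i
    by_cases hi : i ∈ T
    · simp [hi]
    · simp [hi, h1]
  simp only [h2]
  rw [Finset.prod_ite_mem]
  simp

end ExBasics

/-- Bernoulli weights -/
def mub (p : ℝ) : Bool → ℝ := fun b => if b then p else 1 - p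

lemma mub_nonneg {p : ℝ} (h0 : 0 ≤ p) (h1 : p ≤ 1) : ∀ r, 0 ≤ mub p r := by
  intro r; cases r <;> simp [mub] <;> linarith

lemma mub_sum (p : ℝ) : ∑ r, mub p r = 1 := by simp [mub]

lemma Pr_true {ι : Type} [Fintype ι] [DecidableEq ι] (p : ℝ) (T : Finset ι) :
    Pr (mub p) (fun ω => ∀ i ∈ T, ω i = true) = p ^ T.card := by
  have := Pr_all (mub p) (mub_sum p) T {true}
  simpa [mub] using this
end


noncomputable section

/-- weighted sum of the chosen coordinates -/
def wsum {β : Type} [Fintype β] (w : β → ℝ) (ω : β → Bool) : ℝ := ∑ b, if ω b then w b else 0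

/-- truncated square -/
def phi (D d : ℝ) : ℝ := if d ≤ D then d ^ 2 else 0

lemma phi_nonneg (D d : ℝ) : 0 ≤ phi D d := by
  unfold phi; split_ifs <;> positivity

lemma exp_phi {D d R l : ℝ} (hd : 0 ≤ d) (hl : 0 ≤ l) (hR : 0 < R) (h : l * D * R ≤ 1) :
    Real.exp (l * phi D d) ≤ 1 + l * (d ^ 2 * Real.exp (d / R)) := by
  unfold phi
  split_ifs with hD
  · have h1 : l * d ^ 2 ≤ d / R := by
      rw [le_div_iff₀ hR]
      have : l * d * R ≤ 1 := le_trans (by gcongr) h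
      nlinarith
    have h2 : Real.exp (l * d ^ 2) ≤ 1 + l * d ^ 2 * Real.exp (l * d ^ 2) := by
      have h3 := Real.add_one_le_exp (-(l * d ^ 2))
      have h4 : Real.exp (-(l * d ^ 2)) * Real.exp (l * d ^ 2) = 1 := by
        rw [← Real.exp_add]; simp
      nlinarith [Real.exp_pos (l * d ^ 2)]
    refine h2.trans ?_
    have : Real.exp (l * d ^ 2) ≤ Real.exp (d / R) := Real.exp_le_exp.2 h1
    have h5 : 0 ≤ l * d ^ 2 := by positivity
    nlinarith
  · simp only [mul_zero, Real.exp_zero]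
    have : 0 ≤ l * (d ^ 2 * Real.exp (d / R)) := by positivity
    linarith

lemma exp_le_lin {x : ℝ} (h0 : 0 ≤ x) (h1 : x ≤ 1) : Real.exp x ≤ 1 + 2 * x := by
  have h := Real.exp_bound' h0 h1 (n := 3) (by norm_num)
  simp [Finset.sum_range_succ, Nat.factorial] at h
  have : x^2 ≤ x := by nlinarith
  have : x^3 ≤ x := by nlinarith [mul_nonneg h0 h0]
  nlinarith

lemma Ex_pair {β : Type} [Fintype β] [DecidableEq β] {p R a : ℝ} (hp0 : 0 ≤ p) (hp1 : p ≤ 1)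
    (hR : 0 < R) (w : β → ℝ) (w0 : ∀ b, 0 ≤ w b) (wR : ∀ b, w b ≤ R) (wa : ∑ b, w b ≤ a)
    (hpa : 2 * p * a ≤ R) (b b' : β) :
    Ex (mub p) (fun ω : β → Bool => (if ω b then 1 else 0) * (if ω b' then 1 else 0)
      * Real.exp (wsum w ω / R)) ≤ 21 * (p ^ 2 + if b = b' then p else 0) := by
  set T : Finset β := {b, b'} with hT
  let h : β → Bool → ℝ := fun c r => (if c ∈ T then (if r then 1 else 0) else 1) *
    Real.exp ((if r then w c else 0) / R)
  have e1 : Ex (mub p) (fun ω : β → Bool => (if ω b then 1 else 0) * (if ω b' then 1 else 0)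
      * Real.exp (wsum w ω / R)) = Ex (mub p) (fun ω : β → Bool => ∏ c, h c (ω c)) := by
    congr 1
    funext ω
    simp only [h]
    rw [Finset.prod_mul_distrib, ← Real.exp_sum, ← Finset.sum_div]
    unfold wsum
    congr 1
    rw [Finset.prod_ite_mem, Finset.univ_inter]
    by_cases hbb : b = b'
    · subst hbb
      simp [hT]
    · rw [hT, Finset.prod_pair hbb]
  rw [e1, Ex_prod]
  have fac : ∀ c, ∑ r, mub p r * h c r ≤
      (if c ∈ T then p * Real.exp 1 else 1) * Real.exp (2 * p * w c / R) := by
    intro c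
    have hw1 : w c / R ≤ 1 := by rw [div_le_one hR]; exact wR c
    have hw0 : 0 ≤ w c / R := div_nonneg (w0 c) hR.le
    have hE : 1 ≤ Real.exp (2 * p * w c / R) := by
      apply Real.one_le_exp
      have := w0 c
      positivity
    by_cases hc : c ∈ T
    · simp only [Fintype.sum_bool, mub, h, hc, if_true]
      simp
      have h1 : Real.exp (w c / R) ≤ Real.exp 1 := Real.exp_le_exp.2 hw1
      calc p * Real.exp (w c / R) ≤ p * Real.exp 1 := by gcongr
        _ ≤ p * Real.exp 1 * Real.exp (2 * p * w c / R) :=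
          le_mul_of_one_le_right (by positivity) hE
    · simp only [Fintype.sum_bool, mub, h, hc, if_false]
      simp
      have h1 := exp_le_lin hw0 hw1
      have h2 := Real.add_one_le_exp (2 * p * w c / R)
      have h3 : 2 * p * w c / R = p * (2 * (w c / R)) := by ring
      nlinarith
  have fac0 : ∀ c, 0 ≤ ∑ r, mub p r * h c r := by
    intro c
    refine Finset.sum_nonneg fun r _ => mul_nonneg (mub_nonneg hp0 hp1 r) ?_
    simp only [h]
    positivity
  have e2 : ∏ c, ∑ r, mub p r * h c r ≤ (p * Real.exp 1) ^ T.card * Real.exp 1 := by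
    refine (Finset.prod_le_prod (fun c _ => fac0 c) (fun c _ => fac c)).trans ?_
    rw [Finset.prod_mul_distrib, Finset.prod_ite_mem, Finset.univ_inter, Finset.prod_const,
      ← Real.exp_sum]
    refine mul_le_mul_of_nonneg_left ?_ (by positivity)
    apply Real.exp_le_exp.2
    rw [← Finset.sum_div, ← Finset.mul_sum, div_le_one hR]
    refine le_trans ?_ hpa
    gcongr
  refine e2.trans ?_
  have hE := Real.exp_one_lt_d9
  have hE0 := Real.exp_pos 1
  have hE1 : 1 ≤ Real.exp 1 := Real.one_le_exp zero_le_one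
  have h2 : Real.exp 1 ^ 2 ≤ 7.4 := by nlinarith
  have h3 : Real.exp 1 ^ 3 ≤ 21 := by nlinarith
  by_cases hbb : b = b'
  · subst hbb
    have : T.card = 1 := by simp [hT]
    rw [this, if_pos rfl]
    nlinarith [sq_nonneg p]
  · have : T.card = 2 := Finset.card_pair hbb
    rw [this, if_neg hbb]
    nlinarith [sq_nonneg p]

lemma Ex_sq {β : Type} [Fintype β] [DecidableEq β] {p R a : ℝ} (hp0 : 0 ≤ p) (hp1 : p ≤ 1)
    (hR : 0 < R) (w : β → ℝ) (w0 : ∀ b, 0 ≤ w b) (wR : ∀ b, w b ≤ R) (wa : ∑ b, w b ≤ a)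
    (hpa : 2 * p * a ≤ R) :
    Ex (mub p) (fun ω : β → Bool => (wsum w ω) ^ 2 * Real.exp (wsum w ω / R))
      ≤ 21 * (p ^ 2 * a ^ 2 + p * R * a) := by
  have e1 : (fun ω : β → Bool => (wsum w ω) ^ 2 * Real.exp (wsum w ω / R)) =
      fun ω => ∑ b, ∑ b', (w b * w b') * ((if ω b then 1 else 0) * (if ω b' then 1 else 0)
      * Real.exp (wsum w ω / R)) := by
    funext ω
    have : wsum w ω = ∑ b, w b * (if ω b then 1 else 0) := by
      unfold wsum
      exact Finset.sum_congr rfl fun b _ => by split_ifs <;> simp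
    have h2 : (wsum w ω) ^ 2 = ∑ b, ∑ b', (w b * (if ω b then 1 else 0)) *
        (w b' * (if ω b' then 1 else 0)) := by
      rw [sq, ← Finset.sum_mul_sum, ← this]
    rw [h2, Finset.sum_mul]
    refine Finset.sum_congr rfl fun b _ => ?_
    rw [Finset.sum_mul]
    exact Finset.sum_congr rfl fun b' _ => by ring
  rw [e1, Ex_sum]
  have wpos : 0 ≤ ∑ b, w b := Finset.sum_nonneg fun b _ => w0 b
  calc _ ≤ ∑ b, ∑ b', (w b * w b') * (21 * (p ^ 2 + if b = b' then p else 0)) := by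
        refine Finset.sum_le_sum fun b _ => ?_
        rw [Ex_sum]
        refine Finset.sum_le_sum fun b' _ => ?_
        rw [Ex_smul]
        exact mul_le_mul_of_nonneg_left (Ex_pair hp0 hp1 hR w w0 wR wa hpa b b')
          (mul_nonneg (w0 b) (w0 b'))
    _ = 21 * (p ^ 2 * (∑ b, w b) ^ 2 + p * ∑ b, w b ^ 2) := by
        have : ∀ b b', (w b * w b') * (21 * (p ^ 2 + if b = b' then p else 0))
          = 21 * p ^ 2 * (w b * w b') + (if b = b' then 21 * p * (w b * w b') else 0) := by
          intro b b'; split_ifs <;> ring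
        simp only [this, Finset.sum_add_distrib]
        simp only [Finset.sum_ite_eq, Finset.mem_univ, if_true, ← Finset.mul_sum]
        rw [← Finset.sum_mul, sq (∑ b, w b)]
        simp only [← sq]
        ring
    _ ≤ 21 * (p ^ 2 * a ^ 2 + p * R * a) := by
        have h1 : ∑ b, w b ^ 2 ≤ R * a := by
          calc ∑ b, w b ^ 2 ≤ ∑ b, R * w b := Finset.sum_le_sum fun b _ => by
                nlinarith [w0 b, wR b]
            _ = R * ∑ b, w b := by rw [Finset.mul_sum]
            _ ≤ R * a := by gcongr
        rw [mul_assoc p R a]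
        gcongr

lemma Ex_row {β : Type} [Fintype β] [DecidableEq β] {p R a D l : ℝ} (hp0 : 0 ≤ p) (hp1 : p ≤ 1)
    (hR : 0 < R) (w : β → ℝ) (w0 : ∀ b, 0 ≤ w b) (wR : ∀ b, w b ≤ R) (wa : ∑ b, w b ≤ a)
    (hpa : 2 * p * a ≤ R) (hl : 0 ≤ l) (hlD : l * D * R ≤ 1) :
    Ex (mub p) (fun ω : β → Bool => Real.exp (l * phi D (wsum w ω)))
      ≤ Real.exp (l * (21 * (p ^ 2 * a ^ 2 + p * R * a))) := by
  have h1 : Ex (mub p) (fun ω : β → Bool => Real.exp (l * phi D (wsum w ω))) ≤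
      Ex (mub p) (fun ω : β → Bool => 1 + l * ((wsum w ω) ^ 2 * Real.exp (wsum w ω / R))) := by
    refine Ex_mono _ (mub_nonneg hp0 hp1) fun ω => exp_phi ?_ hl hR hlD
    unfold wsum
    exact Finset.sum_nonneg fun b _ => by split_ifs <;> simp [w0]
  rw [Ex_add, Ex_const _ (mub_sum p), Ex_smul] at h1
  have h2 := Ex_sq hp0 hp1 hR w w0 wR wa hpa
  have h3 := Real.add_one_le_exp (l * (21 * (p ^ 2 * a ^ 2 + p * R * a)))
  have h4 := mul_le_mul_of_nonneg_left h2 hl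
  linarith

/-- independence of rows -/
lemma Ex_rows {ι α β : Type} [Fintype ι] [DecidableEq ι] [Fintype α] [DecidableEq α] [Fintype β]
    [DecidableEq β] (p : ℝ) (σ : α × β ≃ ι) (F : α → (β → Bool) → ℝ) :
    Ex (mub p) (fun ω : ι → Bool => ∏ B, F B (fun b => ω (σ (B, b))))
      = ∏ B, Ex (mub p) (F B) := by
  have h := Ex_prod (ι := α) (R := β → Bool) (fun r => ∏ b, mub p (r b)) F
  have h2 : ∏ B, Ex (mub p) (F B) = ∏ B, ∑ r : β → Bool, (∏ b, mub p (r b)) * F B r := rfl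
  rw [h2, ← h]
  unfold Ex
  let e : (ι → Bool) ≃ (α → β → Bool) :=
    (Equiv.arrowCongr σ.symm (Equiv.refl Bool)).trans (Equiv.curry α β Bool)
  rw [← Equiv.sum_comp e]
  refine Finset.sum_congr rfl fun ω _ => ?_
  have e1 : ∀ B b, e ω B b = ω (σ (B, b)) := by
    intro B b
    simp [e, Equiv.arrowCongr, Function.curry]
  have e2 : ∏ i, mub p (ω i) = ∏ B, ∏ b, mub p (e ω B b) := by
    simp only [e1]
    rw [← Equiv.prod_comp σ, Fintype.prod_prod_type]
  rw [e2]
  congr 1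

lemma Pr_light {ι α β : Type} [Fintype ι] [DecidableEq ι] [Fintype α] [DecidableEq α] [Fintype β]
    [DecidableEq β] {p R a D l c : ℝ} (hp0 : 0 ≤ p) (hp1 : p ≤ 1) (σ : α × β ≃ ι)
    (hR : 0 < R) (w : α → β → ℝ) (w0 : ∀ B b, 0 ≤ w B b) (wR : ∀ B b, w B b ≤ R)
    (wa : ∀ B, ∑ b, w B b ≤ a)
    (hpa : 2 * p * a ≤ R) (hl : 0 ≤ l) (hlD : l * D * R ≤ 1) :
    Pr (mub p) (fun ω : ι → Bool => c ≤ ∑ B, phi D (wsum (w B) (fun b => ω (σ (B, b)))))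
      ≤ Real.exp (Fintype.card α * (l * (21 * (p ^ 2 * a ^ 2 + p * R * a))) - l * c) := by
  have h1 := Pr_markov (mub p) (mub_nonneg hp0 hp1)
    (fun ω : ι → Bool => c ≤ ∑ B, phi D (wsum (w B) (fun b => ω (σ (B, b)))))
    (fun ω => ∏ B, Real.exp (l * phi D (wsum (w B) (fun b => ω (σ (B, b))))))
    (Real.exp (l * c)) (Real.exp_pos _) (fun ω => Finset.prod_nonneg fun B _ => (Real.exp_pos _).le)
    (by
      intro ω hω
      rw [← Real.exp_sum, ← Finset.mul_sum]
      exact Real.exp_le_exp.2 (mul_le_mul_of_nonneg_left hω hl))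
  refine h1.trans ?_
  rw [Ex_rows p σ (fun B r => Real.exp (l * phi D (wsum (w B) r))), Real.exp_sub]
  refine div_le_div_of_nonneg_right ?_ (Real.exp_pos _).le
  calc _ ≤ ∏ _B : α, Real.exp (l * (21 * (p ^ 2 * a ^ 2 + p * R * a))) := by
        refine Finset.prod_le_prod (fun B _ => Ex_nonneg _ (mub_nonneg hp0 hp1)
          fun ω => (Real.exp_pos _).le) fun B _ => ?_
        exact Ex_row hp0 hp1 hR (w B) (w0 B) (wR B) (wa B) hpa hl hlD
    _ = _ := by
        rw [Finset.prod_const, ← Real.exp_nat_mul, Finset.card_univ]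
end


noncomputable section
open Classical in
lemma heavy_sum {U W : Type} (S : Finset U) (I : Finset W) (r : U → W → Prop) (D Q : ℝ)
    (hD0 : 0 < D) (hQ0 : 0 ≤ Q)
    (hQ : ∀ B ∈ I, ∀ B' ∈ I, B ≠ B' → (((S.filter fun u => r u B ∧ r u B').card : ℕ) : ℝ) ≤ Q)
    (hD : ∀ B ∈ I, D ≤ (((S.filter fun u => r u B).card : ℕ) : ℝ))
    (hDQ : 2 * S.card * Q ≤ D ^ 2) :
    ∑ B ∈ I, (((S.filter fun u => r u B).card : ℕ) : ℝ) ≤ 2 * S.card := by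
  set T : ℝ := ∑ B ∈ I, (((S.filter fun u => r u B).card : ℕ) : ℝ) with hT
  let f : U → ℝ := fun u => ∑ B ∈ I, if r u B then 1 else 0
  have hTf : T = ∑ u ∈ S, f u := by
    simp only [hT, f]
    rw [Finset.sum_comm]
    refine Finset.sum_congr rfl fun B _ => ?_
    simp
  have hf2 : ∑ u ∈ S, f u ^ 2 ≤ T + I.card ^ 2 * Q := by
    have h1 : ∑ u ∈ S, f u ^ 2 =
        ∑ B ∈ I, ∑ B' ∈ I, (((S.filter fun u => r u B ∧ r u B').card : ℕ) : ℝ) := by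
      simp only [f, sq, Finset.sum_mul_sum]
      rw [Finset.sum_comm]
      refine Finset.sum_congr rfl fun B _ => ?_
      rw [Finset.sum_comm]
      refine Finset.sum_congr rfl fun B' _ => ?_
      rw [Finset.card_filter]
      push_cast
      refine Finset.sum_congr rfl fun u _ => ?_
      by_cases h : r u B <;> by_cases h' : r u B' <;> simp [h, h']
    rw [h1]
    calc _ ≤ ∑ B ∈ I, ∑ B' ∈ I, ((if B = B' then (((S.filter fun u => r u B).card : ℕ) : ℝ) else 0)
            + Q) := by
          refine Finset.sum_le_sum fun B hB => Finset.sum_le_sum fun B' hB' => ?_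
          by_cases h : B = B'
          · subst h; simp [hQ0]
          · simpa [h] using hQ B hB B' hB' h
      _ = _ := by
          simp only [Finset.sum_add_distrib, Finset.sum_ite_eq, Finset.sum_const, nsmul_eq_mul]
          rw [hT]
          congr 1
          · exact Finset.sum_congr rfl fun B hB => by simp [hB]
          · ring
  have hI : I.card * D ≤ T := by
    rw [← nsmul_eq_mul]
    exact Finset.card_nsmul_le_sum _ _ _ hD
  have hCS : T ^ 2 ≤ S.card * ∑ u ∈ S, f u ^ 2 := by
    rw [hTf]; exact sq_sum_le_card_mul_sum_sq
  have hT0 : 0 ≤ T := Finset.sum_nonneg fun _ _ => by positivity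
  have h5 : (I.card * D) ^ 2 ≤ T ^ 2 := by gcongr
  have h6 : (S.card : ℝ) * (I.card ^ 2 * Q) ≤ T ^ 2 / 2 := by
    have := mul_le_mul_of_nonneg_right hDQ (sq_nonneg (I.card : ℝ))
    nlinarith
  have h7 : T ^ 2 ≤ S.card * T + T ^ 2 / 2 := by
    have := mul_le_mul_of_nonneg_left hf2 (Nat.cast_nonneg (α := ℝ) S.card)
    linarith
  by_contra hc
  push Not at hc
  nlinarith [Nat.cast_nonneg (α := ℝ) S.card]

/-- adjacency of blocks -/
def HH {N : ℕ} (ω : Fin N × Fin N → Bool) (i j : Fin N) : Prop :=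
  (i < j ∧ ω (i, j) = true) ∨ (j < i ∧ ω (j, i) = true)

lemma HH_symm {N : ℕ} {ω : Fin N × Fin N → Bool} {i j : Fin N} (h : HH ω i j) : HH ω j i :=
  Or.symm h

open Classical in
/-- degree of block B into S -/
def dg {N : ℕ} {V : Type} (ω : Fin N × Fin N → Bool) (y : V → Fin N) (S : Finset V)
    (B : Fin N) : ℕ := (S.filter fun u => HH ω (y u) B).card

/-- weights -/
def wt {N : ℕ} {V : Type} (y : V → Fin N) (S : Finset V) (b : Fin N) : ℝ :=
  ((S.filter fun u => y u = b).card : ℕ)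

lemma wt_nonneg {N : ℕ} {V : Type} (y : V → Fin N) (S : Finset V) (b : Fin N) : 0 ≤ wt y S b :=
  Nat.cast_nonneg _

lemma wt_sum {N : ℕ} {V : Type} (y : V → Fin N) (S : Finset V) :
    ∑ b, wt y S b = S.card := by
  unfold wt
  rw [← Nat.cast_sum, ← Finset.card_eq_sum_card_fiberwise (fun x _ => Finset.mem_univ (y x))]

open Classical in
lemma card_block {N : ℕ} {V : Type} (y : V → Fin N) (S : Finset V) (P : Fin N → Prop) :
    (((S.filter fun u => P (y u)).card : ℕ) : ℝ) = ∑ b, if P b then wt y S b else 0 := by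
  rw [Finset.card_eq_sum_card_fiberwise (f := y) (t := Finset.univ)
    (fun x _ => Finset.mem_univ (y x))]
  push_cast
  refine Finset.sum_congr rfl fun b _ => ?_
  rw [Finset.filter_filter]
  unfold wt
  split_ifs with h
  · congr 2
    ext u
    simp only [Finset.mem_filter]
    constructor
    · tauto
    · rintro ⟨h1, h2⟩; exact ⟨h1, h2 ▸ h, h2⟩
  · rw [Nat.cast_eq_zero, Finset.card_eq_zero]
    ext u
    simp only [Finset.mem_filter]
    constructor
    · rintro ⟨h1, h2, h3⟩; exact absurd (h3 ▸ h2) h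
    · simp

open Classical in
lemma card_block_le {N : ℕ} {V : Type} (y : V → Fin N) (S : Finset V) (P : Fin N → Prop) (R : ℝ)
    (hR : ∀ b, wt y S b ≤ R) :
    (((S.filter fun u => P (y u)).card : ℕ) : ℝ) ≤ R * ((Finset.univ.filter P).card : ℕ) := by
  rw [card_block]
  rw [← Finset.sum_filter]
  rw [mul_comm, ← nsmul_eq_mul]
  exact Finset.sum_le_card_nsmul _ _ _ fun b _ => hR b

/-- upper weights -/
def wup {N : ℕ} {V : Type} (y : V → Fin N) (S : Finset V) (B b : Fin N) : ℝ :=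
  if B < b then wt y S b else 0
/-- lower weights -/
def wdn {N : ℕ} {V : Type} (y : V → Fin N) (S : Finset V) (B b : Fin N) : ℝ :=
  if b < B then wt y S b else 0

lemma wsum_nonneg {β : Type} [Fintype β] (w : β → ℝ) (w0 : ∀ b, 0 ≤ w b) (ω : β → Bool) :
    0 ≤ wsum w ω := Finset.sum_nonneg fun b _ => by split_ifs <;> simp [w0]

lemma wup_nonneg {N : ℕ} {V : Type} (y : V → Fin N) (S : Finset V) (B b : Fin N) :
    0 ≤ wup y S B b := by unfold wup; split_ifs <;> simp [wt_nonneg]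
lemma wdn_nonneg {N : ℕ} {V : Type} (y : V → Fin N) (S : Finset V) (B b : Fin N) :
    0 ≤ wdn y S B b := by unfold wdn; split_ifs <;> simp [wt_nonneg]
lemma wup_le {N : ℕ} {V : Type} (y : V → Fin N) (S : Finset V) (B b : Fin N) :
    wup y S B b ≤ wt y S b := by unfold wup; split_ifs <;> simp [wt_nonneg]
lemma wdn_le {N : ℕ} {V : Type} (y : V → Fin N) (S : Finset V) (B b : Fin N) :
    wdn y S B b ≤ wt y S b := by unfold wdn; split_ifs <;> simp [wt_nonneg]

lemma dg_eq {N : ℕ} {V : Type} (ω : Fin N × Fin N → Bool) (y : V → Fin N) (S : Finset V)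
    (B : Fin N) : (dg ω y S B : ℝ) = wsum (wup y S B) (fun b => ω (B, b))
      + wsum (wdn y S B) (fun b => ω (b, B)) := by
  classical
  unfold dg
  rw [card_block y S (fun b => HH ω b B)]
  unfold wsum wup wdn
  rw [← Finset.sum_add_distrib]
  refine Finset.sum_congr rfl fun b _ => ?_
  unfold HH
  rcases lt_trichotomy b B with h | h | h
  · have h2 : ¬ B < b := not_lt.2 h.le
    simp [h, h2]
  · subst h; simp
  · have h2 : ¬ b < B := not_lt.2 h.le
    simp [h, h2]

open Classical in
lemma good_det {N : ℕ} {V : Type} (ω : Fin N × Fin N → Bool) (y : V → Fin N) (S : Finset V)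
    {R D c Δ q : ℝ} (hR0 : 0 ≤ R) (hq0 : 0 ≤ q) (hΔ0 : 0 ≤ Δ) (hD0 : 0 < D)
    (hR : ∀ b, wt y S b ≤ R)
    (hΔ : ∀ B, (((Finset.univ.filter fun z => HH ω z B).card : ℕ) : ℝ) ≤ Δ)
    (hq : ∀ B B', B ≠ B' → (((Finset.univ.filter fun z => HH ω z B ∧ HH ω z B').card : ℕ) : ℝ) ≤ q)
    (hDQ : 2 * S.card * (R * q) ≤ D ^ 2)
    (hup : ∑ B, phi D (wsum (wup y S B) (fun b => ω (B, b))) ≤ c)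
    (hdn : ∑ B, phi D (wsum (wdn y S B) (fun b => ω (b, B))) ≤ c) :
    ∑ B, (dg ω y S B : ℝ) ^ 2 ≤ 4 * c + R * Δ * (2 * S.card) := by
  have hmax : ∀ B, (dg ω y S B : ℝ) ≤ R * Δ := by
    intro B
    unfold dg
    refine (card_block_le y S (fun b => HH ω b B) R hR).trans ?_
    exact mul_le_mul_of_nonneg_left (hΔ B) hR0
  have hheavy := heavy_sum S (Finset.univ.filter fun B => D < dg ω y S B) (fun u B => HH ω (y u) B)
    D (R * q) hD0 (by positivity)
    (by
      intro B _ B' _ hBB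
      have h0 := (card_block_le y S (fun b => HH ω b B ∧ HH ω b B') R hR).trans
        (mul_le_mul_of_nonneg_left (by convert hq B B' hBB; rfl) hR0)
      convert h0; rfl)
    (by
      intro B hB
      exact (Finset.mem_filter.1 hB).2.le)
    hDQ
  have hpt : ∀ B, (dg ω y S B : ℝ) ^ 2 ≤
      2 * phi D (wsum (wup y S B) (fun b => ω (B, b))) +
      2 * phi D (wsum (wdn y S B) (fun b => ω (b, B))) +
      R * Δ * (if D < dg ω y S B then (dg ω y S B : ℝ) else 0) := by
    intro B
    have h1 := wsum_nonneg (wup y S B) (wup_nonneg y S B) (fun b => ω (B, b))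
    have h2 := wsum_nonneg (wdn y S B) (wdn_nonneg y S B) (fun b => ω (b, B))
    have h3 := dg_eq ω y S B
    split_ifs with h
    · have := phi_nonneg D (wsum (wup y S B) (fun b => ω (B, b)))
      have := phi_nonneg D (wsum (wdn y S B) (fun b => ω (b, B)))
      have := mul_le_mul_of_nonneg_right (hmax B) (Nat.cast_nonneg (α := ℝ) (dg ω y S B))
      nlinarith
    · push Not at h
      unfold phi
      rw [if_pos (by linarith), if_pos (by linarith), h3]
      nlinarith [sq_nonneg (wsum (wup y S B) (fun b => ω (B, b)) -
        wsum (wdn y S B) (fun b => ω (b, B)))]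
  calc _ ≤ _ := Finset.sum_le_sum fun B _ => hpt B
    _ = 2 * (∑ B, phi D (wsum (wup y S B) (fun b => ω (B, b)))) +
      2 * (∑ B, phi D (wsum (wdn y S B) (fun b => ω (b, B)))) +
      R * Δ * (∑ B ∈ Finset.univ.filter fun B => D < dg ω y S B, (dg ω y S B : ℝ)) := by
        rw [Finset.sum_add_distrib, Finset.sum_add_distrib, Finset.mul_sum, Finset.mul_sum,
          Finset.mul_sum, Finset.sum_filter]
        congr 1
        refine Finset.sum_congr rfl fun B _ => ?_
        split_ifs <;> simp
    _ ≤ _ := by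
        have := mul_le_mul_of_nonneg_left hheavy (mul_nonneg hR0 hΔ0)
        have h9 : ∑ B ∈ Finset.univ.filter (fun B => D < dg ω y S B), (dg ω y S B : ℝ) ≤ 2 * S.card :=
          hheavy
        have := mul_le_mul_of_nonneg_left h9 (mul_nonneg hR0 hΔ0)
        linarith
end


noncomputable section

lemma choose_le_three (m k : ℕ) : (m.choose k : ℝ) ≤ (3 * m / k) ^ k := by
  rcases Nat.eq_zero_or_pos k with rfl | hk
  · simp
  have hk' : (0 : ℝ) < k := by exact_mod_cast hk
  have h1 : (m.choose k : ℝ) ≤ (m : ℝ) ^ k / k.factorial := Nat.choose_le_pow_div k m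
  have h2 : (k : ℝ) ^ k / k.factorial ≤ Real.exp k := Real.pow_div_factorial_le_exp _ hk'.le k
  have h3 : Real.exp k ≤ 3 ^ k := by
    have : Real.exp k = Real.exp 1 ^ k := by rw [← Real.exp_nat_mul]; simp
    rw [this]
    have := Real.exp_one_lt_d9
    gcongr
    linarith
  have hf : (0 : ℝ) < k.factorial := by exact_mod_cast k.factorial_pos
  refine h1.trans ?_
  have h4 : (k : ℝ) ^ k / k.factorial ≤ 3 ^ k := h2.trans h3
  rw [div_le_iff₀ hf] at h4
  rw [div_pow, mul_pow, div_le_div_iff₀ hf (by positivity)]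
  have : (0:ℝ) ≤ (m : ℝ) ^ k := by positivity
  nlinarith

lemma Pr_false {ι R : Type} [Fintype ι] [DecidableEq ι] [Fintype R] (μ : R → ℝ)
    {P : (ι → R) → Prop} (h : ∀ ω, ¬ P ω) : Pr μ P = 0 := by
  unfold Pr Ex
  simp [h]

/-- coordinate of a pair -/
def cd {N : ℕ} (i j : Fin N) : Fin N × Fin N := (min i j, max i j)

lemma HH_cd {N : ℕ} {ω : Fin N × Fin N → Bool} {i j : Fin N} (h : HH ω i j) :
    ω (cd i j) = true := by
  unfold cd
  rcases h with ⟨h1, h2⟩ | ⟨h1, h2⟩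
  · rwa [min_eq_left h1.le, max_eq_right h1.le]
  · rwa [min_eq_right h1.le, max_eq_left h1.le]

lemma HH_ne {N : ℕ} {ω : Fin N × Fin N → Bool} {i j : Fin N} (h : HH ω i j) : i ≠ j := by
  rcases h with ⟨h1, h2⟩ | ⟨h1, h2⟩
  · exact h1.ne
  · exact h1.ne'

lemma cd_eq {N : ℕ} {i j k l : Fin N} (h : cd i j = cd k l) : (i = k ∧ j = l) ∨ (i = l ∧ j = k) := by
  unfold cd at h
  rw [Prod.mk.injEq] at h
  obtain ⟨h1, h2⟩ := h
  rcases le_total i j with a | a <;> rcases le_total k l with b | b <;>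
    simp_all

open Classical in
lemma Pr_deg {N : ℕ} {p : ℝ} (hp0 : 0 ≤ p) (hp1 : p ≤ 1) (B : Fin N) (Δ : ℕ) :
    Pr (mub p) (fun ω : Fin N × Fin N → Bool =>
      Δ ≤ (Finset.univ.filter fun z => HH ω z B).card) ≤ N.choose Δ * p ^ Δ := by
  refine (Pr_mono _ (mub_nonneg hp0 hp1) (Q := fun ω => ∃ Z ∈ Finset.powersetCard Δ Finset.univ,
    ∀ z ∈ Z, HH ω z B) ?_).trans ?_
  · intro ω h
    obtain ⟨Z, hZ, hc⟩ := Finset.exists_subset_card_eq h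
    exact ⟨Z, Finset.mem_powersetCard.2 ⟨Finset.subset_univ _, hc⟩,
      fun z hz => (Finset.mem_filter.1 (hZ hz)).2⟩
  · refine (Pr_union_le _ (mub_nonneg hp0 hp1) _ _ (p ^ Δ) ?_).trans ?_
    · intro Z hZ
      have hc := (Finset.mem_powersetCard.1 hZ).2
      have hinj : Set.InjOn (fun z => cd z B) (Z : Set (Fin N)) := by
        intro z _ z' _ h
        rcases cd_eq h with h | h
        · exact h.1
        · exact h.1.trans h.2
      rw [← hc, ← Finset.card_image_of_injOn hinj, ← Pr_true]
      refine Pr_mono _ (mub_nonneg hp0 hp1) ?_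
      intro ω h e he
      obtain ⟨z, hz, rfl⟩ := Finset.mem_image.1 he
      exact HH_cd (h z hz)
    · simp

open Classical in
lemma Pr_codeg {N : ℕ} {p : ℝ} (hp0 : 0 ≤ p) (hp1 : p ≤ 1) (B B' : Fin N) (hB : B ≠ B') (q : ℕ) :
    Pr (mub p) (fun ω : Fin N × Fin N → Bool =>
      q ≤ (Finset.univ.filter fun z => HH ω z B ∧ HH ω z B').card) ≤ (N * p ^ 2) ^ q := by
  refine (Pr_mono _ (mub_nonneg hp0 hp1) (Q := fun ω => ∃ Z ∈ Finset.powersetCard q Finset.univ,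
    ∀ z ∈ Z, HH ω z B ∧ HH ω z B') ?_).trans ?_
  · intro ω h
    obtain ⟨Z, hZ, hc⟩ := Finset.exists_subset_card_eq h
    exact ⟨Z, Finset.mem_powersetCard.2 ⟨Finset.subset_univ _, hc⟩,
      fun z hz => (Finset.mem_filter.1 (hZ hz)).2⟩
  · refine (Pr_union_le _ (mub_nonneg hp0 hp1) _ _ (p ^ (q + q)) ?_).trans ?_
    · intro Z hZ
      have hc := (Finset.mem_powersetCard.1 hZ).2
      by_cases hBZ : B' ∈ Z
      · rw [Pr_false]
        · positivity
        · intro ω h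
          exact HH_ne (h B' hBZ).2 rfl
      have hinj : ∀ C : Fin N, Set.InjOn (fun z => cd z C) (Z : Set (Fin N)) := by
        intro C z _ z' _ h
        rcases cd_eq h with h | h
        · exact h.1
        · exact h.1.trans h.2
      have hdis : Disjoint (Z.image fun z => cd z B) (Z.image fun z => cd z B') := by
        rw [Finset.disjoint_left]
        intro e he he'
        obtain ⟨z, hz, rfl⟩ := Finset.mem_image.1 he
        obtain ⟨z', hz', h⟩ := Finset.mem_image.1 he'
        rcases cd_eq h with h | h
        · exact hB h.2.symm
        · exact hBZ (h.2 ▸ hz)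
      have hcard : ((Z.image fun z => cd z B) ∪ (Z.image fun z => cd z B')).card = q + q := by
        rw [Finset.card_union_of_disjoint hdis, Finset.card_image_of_injOn (hinj B),
          Finset.card_image_of_injOn (hinj B'), hc]
      rw [← hcard, ← Pr_true]
      refine Pr_mono _ (mub_nonneg hp0 hp1) ?_
      intro ω h e he
      rcases Finset.mem_union.1 he with he | he
      · obtain ⟨z, hz, rfl⟩ := Finset.mem_image.1 he
        exact HH_cd (h z hz).1
      · obtain ⟨z, hz, rfl⟩ := Finset.mem_image.1 he
        exact HH_cd (h z hz).2
    · rw [Finset.card_powersetCard, Finset.card_univ, Fintype.card_fin, mul_pow, ← pow_mul,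
        two_mul]
      refine mul_le_mul_of_nonneg_right ?_ (by positivity)
      exact_mod_cast Nat.choose_le_pow N q

/-- the quasirandomness property -/
def Good {N : ℕ} {V : Type} (ω : Fin N × Fin N → Bool) (y : V → Fin N) (a : ℕ) : Prop :=
  ∀ S : Finset V, S.card = a → ∑ B, (dg ω y S B : ℝ) ^ 2 ≤ (a : ℝ) ^ 2 / 16

lemma good_prob {N : ℕ} {V : Type} [Fintype V] (y : V → Fin N) (a Δ q : ℕ)
    {p R D c l : ℝ} (hp0 : 0 ≤ p) (hp1 : p ≤ 1) (hR0 : 0 < R) (hD0 : 0 < D) (hl : 0 ≤ l)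
    (hR : ∀ b, wt y Finset.univ b ≤ R) (hDQ : 2 * a * (R * q) ≤ D ^ 2)
    (hc : 4 * c + R * Δ * (2 * a) ≤ (a : ℝ) ^ 2 / 16) (hpa : 2 * p * a ≤ R) (hlD : l * D * R ≤ 1) :
    Pr (mub p) (fun ω : Fin N × Fin N → Bool => ¬ Good ω y a) ≤
      N * (N.choose Δ * p ^ Δ) + N ^ 2 * (N * p ^ 2) ^ q +
      2 * ((Fintype.card V).choose a *
        Real.exp (N * (l * (21 * (p ^ 2 * a ^ 2 + p * R * a))) - l * c)) := by
  classical
  have m0 := mub_nonneg hp0 hp1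
  have hRS : ∀ (S : Finset V) b, wt y S b ≤ R := by
    intro S b
    refine le_trans ?_ (hR b)
    unfold wt
    exact_mod_cast Finset.card_le_card (Finset.filter_subset_filter _ (Finset.subset_univ _))
  let E1 : (Fin N × Fin N → Bool) → Prop := fun ω => ∃ B ∈ (Finset.univ : Finset (Fin N)),
    Δ ≤ (Finset.univ.filter fun z => HH ω z B).card
  let E2 : (Fin N × Fin N → Bool) → Prop := fun ω => ∃ x ∈ (Finset.univ : Finset (Fin N)).offDiag,
    q ≤ (Finset.univ.filter fun z => HH ω z x.1 ∧ HH ω z x.2).card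
  let E3 : (Fin N × Fin N → Bool) → Prop := fun ω => ∃ S ∈ Finset.powersetCard a (Finset.univ : Finset V),
    c ≤ ∑ B, phi D (wsum (wup y S B) (fun b => ω ((Equiv.refl (Fin N × Fin N)) (B, b))))
  let E4 : (Fin N × Fin N → Bool) → Prop := fun ω => ∃ S ∈ Finset.powersetCard a (Finset.univ : Finset V),
    c ≤ ∑ B, phi D (wsum (wdn y S B) (fun b => ω ((Equiv.prodComm (Fin N) (Fin N)) (B, b))))
  have hsub : ∀ ω, ¬ Good ω y a → ((E1 ω ∨ E2 ω) ∨ (E3 ω ∨ E4 ω)) := by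
    intro ω hω
    by_contra hno
    push Not at hno
    obtain ⟨⟨h1, h2⟩, h3, h4⟩ := hno
    apply hω
    intro S hS
    have hSm : S ∈ Finset.powersetCard a (Finset.univ : Finset V) :=
      Finset.mem_powersetCard.2 ⟨Finset.subset_univ _, hS⟩
    refine le_trans (good_det ω y S (R := R) (D := D) (c := c) (Δ := Δ) (q := q) hR0.le
      (by positivity) (by positivity) hD0 (hRS S) ?_ ?_ (by rw [hS]; exact hDQ) ?_ ?_)
      (by rw [hS]; exact hc)
    · intro B
      by_contra hB
      push Not at hB
      exact h1 ⟨B, Finset.mem_univ _, by exact_mod_cast hB.le⟩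
    · intro B B' hBB
      by_contra hB
      push Not at hB
      refine h2 ⟨(B, B'), by simp [hBB], ?_⟩
      have := hB.le
      norm_cast at this
    · by_contra hB
      push Not at hB
      exact h3 ⟨S, hSm, hB.le⟩
    · by_contra hB
      push Not at hB
      exact h4 ⟨S, hSm, hB.le⟩
  have b1 : Pr (mub p) E1 ≤ N * (N.choose Δ * p ^ Δ) := by
    refine (Pr_union_le _ m0 _ _ _ fun B _ => Pr_deg hp0 hp1 B Δ).trans ?_
    simp
  have b2 : Pr (mub p) E2 ≤ N ^ 2 * (N * p ^ 2) ^ q := by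
    refine (Pr_union_le _ m0 _ _ ((N * p ^ 2) ^ q) fun x hx => ?_).trans ?_
    · have := Pr_codeg hp0 hp1 x.1 x.2 (Finset.mem_offDiag.1 hx).2.2 q
      convert this
    · refine mul_le_mul_of_nonneg_right ?_ (by positivity)
      rw [Finset.offDiag_card, Finset.card_univ, Fintype.card_fin]
      have : N * N - N ≤ N ^ 2 := by rw [sq]; exact Nat.sub_le _ _
      exact_mod_cast this
  have b3 : Pr (mub p) E3 ≤ (Fintype.card V).choose a *
        Real.exp (N * (l * (21 * (p ^ 2 * a ^ 2 + p * R * a))) - l * c) := by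
    refine (Pr_union_le _ m0 _ _
      (Real.exp (N * (l * (21 * (p ^ 2 * a ^ 2 + p * R * a))) - l * c))
      fun S hS => ?_).trans (le_of_eq ?_)
    · have hS' := (Finset.mem_powersetCard.1 hS).2
      have := Pr_light (R := R) (a := a) (D := D) (l := l) (c := c) hp0 hp1
        (Equiv.refl (Fin N × Fin N)) hR0 (wup y S) (wup_nonneg y S)
        (fun B b => (wup_le y S B b).trans (hRS S b))
        (fun B => by
          refine (Finset.sum_le_sum fun b _ => wup_le y S B b).trans ?_
          rw [wt_sum, hS']) hpa hl hlD
      rwa [Fintype.card_fin] at this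
    · rw [Finset.card_powersetCard, Finset.card_univ]
  have b4 : Pr (mub p) E4 ≤ (Fintype.card V).choose a *
        Real.exp (N * (l * (21 * (p ^ 2 * a ^ 2 + p * R * a))) - l * c) := by
    refine (Pr_union_le _ m0 _ _
      (Real.exp (N * (l * (21 * (p ^ 2 * a ^ 2 + p * R * a))) - l * c))
      fun S hS => ?_).trans (le_of_eq ?_)
    · have hS' := (Finset.mem_powersetCard.1 hS).2
      have := Pr_light (R := R) (a := a) (D := D) (l := l) (c := c) hp0 hp1
        (Equiv.prodComm (Fin N) (Fin N)) hR0 (wdn y S) (wdn_nonneg y S)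
        (fun B b => (wdn_le y S B b).trans (hRS S b))
        (fun B => by
          refine (Finset.sum_le_sum fun b _ => wdn_le y S B b).trans ?_
          rw [wt_sum, hS']) hpa hl hlD
      rwa [Fintype.card_fin] at this
    · rw [Finset.card_powersetCard, Finset.card_univ]
  have hA := Pr_mono (mub p) m0 hsub
  have hB := Pr_or (mub p) m0 (fun ω => E1 ω ∨ E2 ω) (fun ω => E3 ω ∨ E4 ω)
  have hC := Pr_or (mub p) m0 E1 E2
  have hE := Pr_or (mub p) m0 E3 E4
  linarith
end


noncomputable section

/-- pairs with a common neighbouring block -/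
def Cls {N : ℕ} {V : Type} (ω : Fin N × Fin N → Bool) (y : V → Fin N) (u v : V) : Prop :=
  ∃ B, HH ω (y u) B ∧ HH ω (y v) B

/-- pairs closed by a smaller block -/
def Own {N : ℕ} {V : Type} (ω : Fin N × Fin N → Bool) (y : V → Fin N) (u v : V) : Prop :=
  ∃ l, l < y u ∧ l < y v ∧ ω (l, y u) = true ∧ ω (l, y v) = true

open Classical in
lemma card_Cls {N : ℕ} {V : Type} (ω : Fin N × Fin N → Bool) (y : V → Fin N) (a : ℕ)
    (hg : Good ω y a) (S : Finset V) (hS : S.card = a) :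
    ((((S ×ˢ S).filter fun z => Cls ω y z.1 z.2).card : ℕ) : ℝ) ≤ (a : ℝ) ^ 2 / 16 := by
  refine le_trans ?_ (hg S hS)
  have h1 : (S ×ˢ S).filter (fun z => Cls ω y z.1 z.2) ⊆ (Finset.univ : Finset (Fin N)).biUnion
      fun B => (S.filter fun u => HH ω (y u) B) ×ˢ (S.filter fun u => HH ω (y u) B) := by
    intro z hz
    simp only [Finset.mem_filter, Finset.mem_product] at hz
    obtain ⟨⟨h1, h2⟩, B, h3, h4⟩ := hz
    simp only [Finset.mem_biUnion, Finset.mem_product, Finset.mem_filter, Finset.mem_univ, true_and]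
    exact ⟨B, ⟨h1, h3⟩, h2, h4⟩
  have h2 := (Finset.card_le_card h1).trans Finset.card_biUnion_le
  simp only [Finset.card_product] at h2
  have h3 : ((((S ×ˢ S).filter fun z => Cls ω y z.1 z.2).card : ℕ) : ℝ) ≤
    ((∑ B : Fin N, (S.filter fun u => HH ω (y u) B).card * (S.filter fun u => HH ω (y u) B).card : ℕ) : ℝ) := by
    exact_mod_cast h2
  refine h3.trans (le_of_eq ?_)
  push_cast
  refine Finset.sum_congr rfl fun B _ => ?_
  unfold dg
  ring

open Classical in
lemma card_lt_pairs {N : ℕ} {V : Type} (x : V → Fin N) (S : Finset V)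
    (hx : Set.InjOn x (S : Set V)) :
    S.card * S.card ≤ 2 * ((S ×ˢ S).filter fun z => x z.1 < x z.2).card + S.card := by
  have h1 : S ×ˢ S ⊆ (((S ×ˢ S).filter fun z => x z.1 < x z.2) ∪
      (((S ×ˢ S).filter fun z => x z.1 < x z.2).image Prod.swap)) ∪ S.image (fun u => (u, u)) := by
    intro z hz
    obtain ⟨u, v⟩ := z
    have huv := Finset.mem_product.1 hz
    simp only [Finset.mem_union, Finset.mem_filter, Finset.mem_image]
    rcases lt_trichotomy (x u) (x v) with h | h | h
    · exact Or.inl (Or.inl ⟨hz, h⟩)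
    · refine Or.inr ⟨u, huv.1, ?_⟩
      have huv' : u = v := hx huv.1 huv.2 h
      rw [huv']
    · exact Or.inl (Or.inr ⟨(v, u), ⟨Finset.mem_product.2 ⟨huv.2, huv.1⟩, h⟩, rfl⟩)
  have h2 := Finset.card_le_card h1
  rw [Finset.card_product] at h2
  have h3 := Finset.card_union_le (((S ×ˢ S).filter fun z => x z.1 < x z.2) ∪
      (((S ×ˢ S).filter fun z => x z.1 < x z.2).image Prod.swap)) (S.image (fun u => (u, u)))
  have h4 := Finset.card_union_le ((S ×ˢ S).filter fun z => x z.1 < x z.2)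
      (((S ×ˢ S).filter fun z => x z.1 < x z.2).image Prod.swap)
  have h5 := Finset.card_image_le (s := (S ×ˢ S).filter fun z => x z.1 < x z.2) (f := Prod.swap)
  have h6 := Finset.card_image_le (s := S) (f := fun u => (u, u))
  omega

open Classical in
lemma own_prob {N : ℕ} {V : Type} (x : V → Fin N) (S : Finset V) (hx : Set.InjOn x (S : Set V))
    (a : ℕ) (hS : S.card = a) (ha : 2 ≤ a) (dead : V → V → Prop)
    (hdead : ((((S ×ˢ S).filter fun z => dead z.1 z.2).card : ℕ) : ℝ) ≤ (a : ℝ) ^ 2 / 16)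
    {p : ℝ} (hp0 : 0 ≤ p) (hp1 : p ≤ 1) :
    Pr (mub p) (fun ω : Fin N × Fin N → Bool => Good ω x a ∧
      ∀ u ∈ S, ∀ v ∈ S, x u < x v → ω (x u, x v) = true → dead u v ∨ Own ω x u v)
      ≤ Real.exp (-(p * a ^ 2 / 8)) := by
  let opn : (Fin N × Fin N → Bool) → Fin N × Fin N → Prop := fun ω e =>
    ∃ u ∈ S, ∃ v ∈ S, x u = e.1 ∧ x v = e.2 ∧ x u < x v ∧ ¬ dead u v ∧
      ¬ ∃ l, l < e.1 ∧ ω (l, e.1) = true ∧ ω (l, e.2) = true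
  let g : Fin N × Fin N → (Fin N × Fin N → Bool) → ℝ := fun e ω =>
    if opn ω e then (if ω e then 0 else Real.exp p) else 1
  have g0 : ∀ e ω, 0 ≤ g e ω := by
    intro e ω; simp only [g]; split_ifs <;> positivity
  have hopn : ∀ e f : Fin N × Fin N, (e.1 : ℕ) ≤ f.1 → ∀ ω r,
      opn (Function.update ω f r) e ↔ opn ω e := by
    intro e f hef ω r
    have key : ∀ l, l < e.1 → ∀ j, Function.update ω f r (l, j) = ω (l, j) := by
      intro l hl j
      rw [Function.update_of_ne]
      rintro rfl
      have : (l : ℕ) < e.1 := hl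
      simp only at hef
      omega
    have : (∃ l, l < e.1 ∧ Function.update ω f r (l, e.1) = true ∧
        Function.update ω f r (l, e.2) = true) ↔
        (∃ l, l < e.1 ∧ ω (l, e.1) = true ∧ ω (l, e.2) = true) := by
      refine exists_congr fun l => and_congr_right fun hl => ?_
      rw [key l hl, key l hl]
    simp only [opn, this]
  have hsup := Ex_super (mub p) (mub_nonneg hp0 hp1) (mub_sum p)
    (fun e : Fin N × Fin N => (e.1 : ℕ)) g g0
    (by
      intro e f hfe hr ω r
      simp only [g, hopn e f hr ω r]
      rw [Function.update_of_ne (Ne.symm hfe)])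
    (by
      intro e ω
      simp only [g, hopn e e le_rfl ω, Function.update_self, Fintype.sum_bool, mub]
      by_cases h : opn ω e
      · simp only [h, if_true]
        simp
        have h1 := Real.add_one_le_exp (-p)
        have h2 : Real.exp (-p) * Real.exp p = 1 := by rw [← Real.exp_add]; simp
        nlinarith [Real.exp_pos p]
      · simp [h]) Finset.univ
  have hm := Pr_markov (mub p) (mub_nonneg hp0 hp1) (fun ω : Fin N × Fin N → Bool => Good ω x a ∧
      ∀ u ∈ S, ∀ v ∈ S, x u < x v → ω (x u, x v) = true → dead u v ∨ Own ω x u v)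
    (fun ω => ∏ e, g e ω) (Real.exp (p * a ^ 2 / 8)) (Real.exp_pos _)
    (fun ω => Finset.prod_nonneg fun e _ => g0 e ω) (by
      rintro ω ⟨hg, hω⟩
      have hprod : ∏ e, g e ω = Real.exp (p * ((Finset.univ.filter fun e => opn ω e).card : ℕ)) := by
        have : ∀ e, g e ω = if opn ω e then Real.exp p else 1 := by
          intro e
          simp only [g]
          by_cases h : opn ω e
          · simp only [h, if_true]
            rw [if_neg]
            intro he
            obtain ⟨u, hu, v, hv, h1, h2, h3, h4, h5⟩ := h
            have he' : e = (x u, x v) := by rw [h1, h2]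
            rcases hω u hu v hv h3 (by rw [← he']; exact he) with h6 | ⟨l, h6, h7, h8, h9⟩
            · exact h4 h6
            · exact h5 ⟨l, by rw [← h1]; exact h6, by rw [← h1]; exact h8, by
                rw [← h2]; exact h9⟩
          · simp [h]
        simp only [this]
        rw [Finset.prod_ite]
        simp only [Finset.prod_const, one_pow, mul_one]
        rw [← Real.exp_nat_mul, mul_comm]
      rw [hprod]
      apply Real.exp_le_exp.2
      have hcl := card_Cls ω x a hg S hS
      have hpairs := card_lt_pairs x S hx
      rw [hS] at hpairs
      have hcover : ((S ×ˢ S).filter fun z => x z.1 < x z.2).card ≤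
          (Finset.univ.filter fun e => opn ω e).card +
          ((S ×ˢ S).filter fun z => dead z.1 z.2).card +
          ((S ×ˢ S).filter fun z => Cls ω x z.1 z.2).card := by
        have h1 : (S ×ˢ S).filter (fun z => x z.1 < x z.2) ⊆
            (((S ×ˢ S).filter fun z => opn ω (x z.1, x z.2)) ∪
            ((S ×ˢ S).filter fun z => dead z.1 z.2)) ∪
            ((S ×ˢ S).filter fun z => Cls ω x z.1 z.2) := by
          intro z hz
          obtain ⟨u, v⟩ := z
          simp only [Finset.mem_union, Finset.mem_filter] at hz ⊢
          obtain ⟨h1, h2⟩ := hz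
          have h3 := Finset.mem_product.1 h1
          by_cases hd : dead u v
          · exact Or.inl (Or.inr ⟨h1, hd⟩)
          by_cases ho : ∃ l, l < x u ∧ ω (l, x u) = true ∧ ω (l, x v) = true
          · obtain ⟨l, h4, h5, h6⟩ := ho
            exact Or.inr ⟨h1, l, Or.inr ⟨h4, h5⟩, Or.inr ⟨h4.trans h2, h6⟩⟩
          · exact Or.inl (Or.inl ⟨h1, u, h3.1, v, h3.2, rfl, rfl, h2, hd, ho⟩)
        have h2 := Finset.card_le_card h1
        have h3 := Finset.card_union_le (((S ×ˢ S).filter fun z => opn ω (x z.1, x z.2)) ∪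
            ((S ×ˢ S).filter fun z => dead z.1 z.2)) ((S ×ˢ S).filter fun z => Cls ω x z.1 z.2)
        have h4 := Finset.card_union_le ((S ×ˢ S).filter fun z => opn ω (x z.1, x z.2))
            ((S ×ˢ S).filter fun z => dead z.1 z.2)
        have h5 : ((S ×ˢ S).filter fun z => opn ω (x z.1, x z.2)).card ≤
            (Finset.univ.filter fun e => opn ω e).card := by
          refine Finset.card_le_card_of_injOn (fun z => (x z.1, x z.2)) ?_ ?_
          · intro z hz
            simp only [Finset.coe_filter, Finset.mem_univ, true_and, Set.mem_ofPred_eq]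
            exact (Finset.mem_filter.1 hz).2
          · intro z hz z' hz' h
            have h6 := Finset.mem_product.1 (Finset.mem_filter.1 hz).1
            have h7 := Finset.mem_product.1 (Finset.mem_filter.1 hz').1
            simp only [Prod.mk.injEq] at h
            exact Prod.ext (hx h6.1 h7.1 h.1) (hx h6.2 h7.2 h.2)
        omega
      have hcoverR : ((((S ×ˢ S).filter fun z => x z.1 < x z.2).card : ℕ) : ℝ) ≤
          ((Finset.univ.filter fun e => opn ω e).card : ℕ) +
          (((S ×ˢ S).filter fun z => dead z.1 z.2).card : ℕ) +
          (((S ×ˢ S).filter fun z => Cls ω x z.1 z.2).card : ℕ) := by exact_mod_cast hcover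
      have hpairsR : (a : ℝ) * a ≤ 2 * (((S ×ˢ S).filter fun z => x z.1 < x z.2).card : ℕ) + a := by
        exact_mod_cast hpairs
      have haR : (2 : ℝ) ≤ a := by exact_mod_cast ha
      have : (a : ℝ) ^ 2 / 8 ≤ ((Finset.univ.filter fun e => opn ω e).card : ℕ) := by nlinarith
      have := mul_le_mul_of_nonneg_left this hp0
      linarith)
  refine hm.trans ?_
  rw [Real.exp_neg, div_eq_mul_inv]
  exact mul_le_of_le_one_left (by positivity) hsup
end


noncomputable section

open Classical in
lemma part_exists {N : ℕ} {V : Type} [Fintype V] (x1 : V → Fin N) (T R a k : ℕ)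
    (hT : ∀ b, (Finset.univ.filter fun u => x1 u = b).card ≤ T) (hN : 0 < N) (haN : a ≤ N)
    (hprob : (N : ℝ) * ((Fintype.card V).choose R * (1 / N) ^ R) +
      N.choose a * (N.choose a * ((T * a).choose k * ((a : ℝ) / N) ^ k)) < 1) :
    ∃ x2 : V → Fin N, (∀ b, wt x2 Finset.univ b ≤ R) ∧
      ∀ S : Finset V, S.card = k → a ≤ (S.image x1).card ∨ a ≤ (S.image x2).card := by
  let μ : Fin N → ℝ := fun _ => 1 / N
  have hN' : (0 : ℝ) < N := by exact_mod_cast hN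
  have m0 : ∀ r, 0 ≤ μ r := fun r => by positivity
  have m1 : ∑ r, μ r = 1 := by simp [μ]; field_simp
  let E1 : (V → Fin N) → Prop := fun ω => ∃ b ∈ (Finset.univ : Finset (Fin N)),
    ∃ F ∈ Finset.powersetCard R (Finset.univ : Finset V), ∀ i ∈ F, ω i ∈ ({b} : Finset (Fin N))
  let E2 : (V → Fin N) → Prop := fun ω => ∃ A1 ∈ Finset.powersetCard a (Finset.univ : Finset (Fin N)),
    ∃ A2 ∈ Finset.powersetCard a (Finset.univ : Finset (Fin N)),
    ∃ S ∈ Finset.powersetCard k (Finset.univ.filter fun u => x1 u ∈ A1), ∀ i ∈ S, ω i ∈ A2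
  have b1 : Pr μ E1 ≤ (N : ℝ) * ((Fintype.card V).choose R * (1 / N) ^ R) := by
    refine (Pr_union_le _ m0 _ _ ((Fintype.card V).choose R * (1 / N) ^ R) fun b _ => ?_).trans
      (by simp)
    refine (Pr_union_le _ m0 _ _ ((1 / N) ^ R) fun F hF => ?_).trans
      (by simp)
    rw [Pr_all μ m1, (Finset.mem_powersetCard.1 hF).2]
    simp [μ]
  have b2 : Pr μ E2 ≤ N.choose a * (N.choose a * ((T * a).choose k * ((a : ℝ) / N) ^ k)) := by
    refine (Pr_union_le _ m0 _ _ (N.choose a * ((T * a).choose k * ((a : ℝ) / N) ^ k))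
      fun A1 hA1 => ?_).trans (by simp)
    refine (Pr_union_le _ m0 _ _ ((T * a).choose k * ((a : ℝ) / N) ^ k)
      fun A2 hA2 => ?_).trans (by simp)
    refine (Pr_union_le _ m0 _ _ (((a : ℝ) / N) ^ k)
      fun S hS => ?_).trans ?_
    · rw [Pr_all μ m1, (Finset.mem_powersetCard.1 hS).2]
      simp only [μ, Finset.sum_const, (Finset.mem_powersetCard.1 hA2).2, nsmul_eq_mul]
      rw [mul_one_div]
    · refine mul_le_mul_of_nonneg_right ?_ (by positivity)
      rw [Finset.card_powersetCard]
      have : (Finset.univ.filter fun u => x1 u ∈ A1).card ≤ T * a := by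
        have h := Finset.card_le_mul_card_image_of_maps_to (f := x1)
          (s := Finset.univ.filter fun u => x1 u ∈ A1) (t := A1)
          (fun u hu => (Finset.mem_filter.1 hu).2) T (fun b _ =>
            (Finset.card_le_card (Finset.filter_subset_filter _ (Finset.subset_univ _))).trans (hT b))
        rwa [(Finset.mem_powersetCard.1 hA1).2] at h
      exact_mod_cast Nat.choose_le_choose k this
  have hlt : Pr μ (fun ω => E1 ω ∨ E2 ω) < 1 := by
    have := Pr_or μ m0 E1 E2
    linarith
  obtain ⟨x2, hx2⟩ := Pr_exists μ m0 m1 hlt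
  push Not at hx2
  obtain ⟨h1, h2⟩ := hx2
  refine ⟨x2, ?_, ?_⟩
  · intro b
    by_contra hb
    push Not at hb
    unfold wt at hb
    have hb' : R ≤ (Finset.univ.filter fun u => x2 u = b).card := by
      have := hb.le
      norm_cast at this
    obtain ⟨F, hF, hFc⟩ := Finset.exists_subset_card_eq hb'
    refine h1 ⟨b, Finset.mem_univ _, F, Finset.mem_powersetCard.2 ⟨Finset.subset_univ _, hFc⟩, ?_⟩
    intro i hi
    simpa using (Finset.mem_filter.1 (hF hi)).2
  · intro S hS
    by_contra hcon
    push Not at hcon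
    obtain ⟨A1, hA1, hA1c⟩ := Finset.exists_superset_card_eq hcon.1.le (by simpa using haN)
    obtain ⟨A2, hA2, hA2c⟩ := Finset.exists_superset_card_eq hcon.2.le (by simpa using haN)
    refine h2 ⟨A1, Finset.mem_powersetCard.2 ⟨Finset.subset_univ _, hA1c⟩, A2,
      Finset.mem_powersetCard.2 ⟨Finset.subset_univ _, hA2c⟩, S,
      Finset.mem_powersetCard.2 ⟨?_, hS⟩, ?_⟩
    · intro u hu
      exact Finset.mem_filter.2 ⟨Finset.mem_univ _, hA1 (Finset.mem_image_of_mem _ hu)⟩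
    · intro u hu
      exact hA2 (Finset.mem_image_of_mem _ hu)
end


noncomputable section

lemma Ex_comm {ι R : Type} [Fintype ι] [DecidableEq ι] [Fintype R] (μ : R → ℝ)
    (f : (ι → R) → (ι → R) → ℝ) :
    Ex μ (fun ω => Ex μ (fun η => f ω η)) = Ex μ (fun η => Ex μ (fun ω => f ω η)) := by
  unfold Ex
  simp only [Finset.mul_sum]
  rw [Finset.sum_comm]
  refine Finset.sum_congr rfl fun _ _ => Finset.sum_congr rfl fun _ _ => by ring

lemma Pr_nonneg {ι R : Type} [Fintype ι] [DecidableEq ι] [Fintype R] (μ : R → ℝ)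
    (h0 : ∀ r, 0 ≤ μ r) (P : (ι → R) → Prop) : 0 ≤ Pr μ P := by
  unfold Pr
  exact Ex_nonneg μ h0 fun ω => by split_ifs <;> norm_num

/-- some small set is bad -/
def BadS {N : ℕ} {V : Type} (x : V → Fin N) (a : ℕ) (dead : V → V → Prop)
    (ω : Fin N × Fin N → Bool) : Prop :=
  ∃ S : Finset V, S.card = a ∧ Set.InjOn x (S : Set V) ∧
    ∀ u ∈ S, ∀ v ∈ S, x u < x v → ω (x u, x v) = true → dead u v ∨ Own ω x u v

open Classical in
lemma bad_prob {N : ℕ} {V : Type} [Fintype V] (x : V → Fin N)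
    (a : ℕ) (ha : 2 ≤ a) (dead : V → V → Prop)
    (hdead : ∀ S : Finset V, S.card = a →
      ((((S ×ˢ S).filter fun z => dead z.1 z.2).card : ℕ) : ℝ) ≤ (a : ℝ) ^ 2 / 16)
    {p : ℝ} (hp0 : 0 ≤ p) (hp1 : p ≤ 1) :
    Pr (mub p) (fun ω : Fin N × Fin N → Bool => Good ω x a ∧ BadS x a dead ω)
      ≤ (Fintype.card V).choose a * Real.exp (-(p * a ^ 2 / 8)) := by
  have m0 := mub_nonneg hp0 hp1
  refine (Pr_mono _ m0 (Q := fun ω => ∃ S ∈ (Finset.powersetCard a (Finset.univ : Finset V)).filter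
    (fun S : Finset V => Set.InjOn x (S : Set V)), Good ω x a ∧ ∀ u ∈ S, ∀ v ∈ S, x u < x v →
      ω (x u, x v) = true → dead u v ∨ Own ω x u v) ?_).trans ?_
  · rintro ω ⟨hg, S, h1, h2, h3⟩
    exact ⟨S, Finset.mem_filter.2 ⟨Finset.mem_powersetCard.2 ⟨Finset.subset_univ _, h1⟩, h2⟩, hg, h3⟩
  refine (Pr_union_le _ m0 _ _ (Real.exp (-(p * a ^ 2 / 8))) fun S hS => ?_).trans ?_
  · have h := Finset.mem_filter.1 hS
    have hc := (Finset.mem_powersetCard.1 h.1).2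
    exact own_prob x S h.2 a hc ha dead (hdead S hc) hp0 hp1
  · refine mul_le_mul_of_nonneg_right ?_ (by positivity)
    have := (Finset.card_filter_le (Finset.powersetCard a (Finset.univ : Finset V))
      (fun S : Finset V => Set.InjOn x (S : Set V)))
    rw [Finset.card_powersetCard, Finset.card_univ] at this
    exact_mod_cast this

open Classical in
lemma omega_exists {N : ℕ} {V : Type} [Fintype V] (x1 x2 : V → Fin N)
    (a : ℕ) (ha : 2 ≤ a) {p g : ℝ} (hp0 : 0 ≤ p) (hp1 : p ≤ 1)
    (hg1 : Pr (mub p) (fun ω : Fin N × Fin N → Bool => ¬ Good ω x1 a) ≤ g)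
    (hg2 : Pr (mub p) (fun ω : Fin N × Fin N → Bool => ¬ Good ω x2 a) ≤ g)
    (hlt : 2 * g + 2 * ((Fintype.card V).choose a * Real.exp (-(p * a ^ 2 / 8))) < 1) :
    ∃ ω1 ω2 : Fin N × Fin N → Bool,
      ¬ BadS x1 a (Cls ω2 x2) ω1 ∧ ¬ BadS x2 a (Cls ω1 x1) ω2 := by
  set e := (Fintype.card V).choose a * Real.exp (-(p * a ^ 2 / 8)) with he
  have he0 : 0 ≤ e := by positivity
  have m0 := mub_nonneg hp0 hp1
  have m1 := mub_sum p
  have key : ∀ (x y : V → Fin N) (η : Fin N × Fin N → Bool),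
      Pr (mub p) (fun ω : Fin N × Fin N → Bool => Good η y a ∧ Good ω x a ∧ BadS x a (Cls η y) ω) ≤ e := by
    intro x y η
    by_cases hη : Good η y a
    · refine (Pr_mono _ m0 (fun ω h => h.2)).trans ?_
      exact bad_prob x a ha (Cls η y) (fun S hS => card_Cls η y a hη S hS) hp0 hp1
    · refine le_trans (le_of_eq ?_) he0
      unfold Pr
      simp only [hη, false_and, if_false]
      exact Ex_const _ m1 0
  have hB1 : Ex (mub p) (fun ω1 : Fin N × Fin N → Bool => Pr (mub p)
      (fun ω2 : Fin N × Fin N → Bool => Good ω2 x2 a ∧ Good ω1 x1 a ∧ BadS x1 a (Cls ω2 x2) ω1)) ≤ e := by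
    unfold Pr
    rw [Ex_comm]
    refine (Ex_mono _ m0 (fun ω2 => ?_)).trans (le_of_eq (Ex_const _ m1 e))
    exact key x1 x2 ω2
  have hB2 : Ex (mub p) (fun ω1 : Fin N × Fin N → Bool => Pr (mub p)
      (fun ω2 : Fin N × Fin N → Bool => Good ω1 x1 a ∧ Good ω2 x2 a ∧ BadS x2 a (Cls ω1 x1) ω2)) ≤ e := by
    refine (Ex_mono _ m0 (fun ω1 => ?_)).trans (le_of_eq (Ex_const _ m1 e))
    exact key x2 x1 ω1
  let f : (Fin N × Fin N → Bool) → ℝ := fun ω1 => ((if ¬ Good ω1 x1 a then 1 else 0) + g) + (Pr (mub p)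
      (fun ω2 : Fin N × Fin N → Bool => Good ω2 x2 a ∧ Good ω1 x1 a ∧ BadS x1 a (Cls ω2 x2) ω1) +
      Pr (mub p)
      (fun ω2 : Fin N × Fin N → Bool => Good ω1 x1 a ∧ Good ω2 x2 a ∧ BadS x2 a (Cls ω1 x1) ω2))
  have hf : Ex (mub p) f < 1 := by
    simp only [f]
    rw [Ex_add, Ex_add, Ex_add, Ex_const _ m1]
    have : Ex (mub p) (fun ω : Fin N × Fin N → Bool => if ¬ Good ω x1 a then (1:ℝ) else 0) ≤ g := by
      unfold Pr at hg1; convert hg1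
    linarith
  obtain ⟨ω1, hω1⟩ := Ex_exists_lt _ m0 m1 hf
  simp only [f] at hω1
  have n1 := Pr_nonneg (mub p) m0 (fun ω2 : Fin N × Fin N → Bool => (Good ω2 x2 a ∧ Good ω1 x1 a ∧ BadS x1 a (Cls ω2 x2) ω1))
  have n2 := Pr_nonneg (mub p) m0 (fun ω2 : Fin N × Fin N → Bool => (Good ω1 x1 a ∧ Good ω2 x2 a ∧ BadS x2 a (Cls ω1 x1) ω2))
  have n3 := Pr_nonneg (mub p) m0 (fun ω : Fin N × Fin N → Bool => ¬ Good ω x2 a)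
  have hgood : Good ω1 x1 a := by
    by_contra h
    rw [if_pos h] at hω1
    linarith
  rw [if_neg (not_not.2 hgood)] at hω1
  have hP := Pr_or (mub p) m0 (fun ω2 : Fin N × Fin N → Bool => ¬ Good ω2 x2 a)
    (fun ω2 => (Good ω2 x2 a ∧ Good ω1 x1 a ∧ BadS x1 a (Cls ω2 x2) ω1) ∨
      (Good ω1 x1 a ∧ Good ω2 x2 a ∧ BadS x2 a (Cls ω1 x1) ω2))
  have hQ := Pr_or (mub p) m0
    (fun ω2 => (Good ω2 x2 a ∧ Good ω1 x1 a ∧ BadS x1 a (Cls ω2 x2) ω1))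
      (fun ω2 => (Good ω1 x1 a ∧ Good ω2 x2 a ∧ BadS x2 a (Cls ω1 x1) ω2))
  obtain ⟨ω2, hω2⟩ := Pr_exists (mub p) m0 m1 (lt_of_le_of_lt (hP.trans (add_le_add hg2 hQ)) (by linarith))
  push Not at hω2
  refine ⟨ω1, ω2, hω2.2.1 hω2.1 hgood, hω2.2.2 hgood hω2.1⟩

/-- one colour of edges -/
def Edg {N : ℕ} {V : Type} (ω η : Fin N × Fin N → Bool) (x y : V → Fin N) (u v : V) : Prop :=
  HH ω (x u) (x v) ∧ ¬ Cls η y u v ∧ ¬ Own ω x u v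

lemma Cls_symm {N : ℕ} {V : Type} {ω : Fin N × Fin N → Bool} {x : V → Fin N} {u v : V}
    (h : Cls ω x u v) : Cls ω x v u := by
  obtain ⟨B, h1, h2⟩ := h
  exact ⟨B, h2, h1⟩

lemma Own_symm {N : ℕ} {V : Type} {ω : Fin N × Fin N → Bool} {x : V → Fin N} {u v : V}
    (h : Own ω x u v) : Own ω x v u := by
  obtain ⟨B, h1, h2, h3, h4⟩ := h
  exact ⟨B, h2, h1, h4, h3⟩

lemma Edg_symm {N : ℕ} {V : Type} {ω η : Fin N × Fin N → Bool} {x y : V → Fin N} {u v : V}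
    (h : Edg ω η x y u v) : Edg ω η x y v u :=
  ⟨HH_symm h.1, fun h' => h.2.1 (Cls_symm h'), fun h' => h.2.2 (Own_symm h')⟩

lemma Edg_mix {N : ℕ} {V : Type} {ω η : Fin N × Fin N → Bool} {x y : V → Fin N} {u v w : V}
    (h1 : Edg ω η x y u v) (h2 : Edg ω η x y u w) (h3 : Edg η ω y x v w) : False :=
  h3.2.1 ⟨x u, HH_symm h1.1, HH_symm h2.1⟩

lemma Edg_mono {N : ℕ} {V : Type} {ω η : Fin N × Fin N → Bool} {x y : V → Fin N} {u v w : V}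
    (h1 : Edg ω η x y u v) (h2 : Edg ω η x y u w) (h3 : Edg ω η x y v w) : False := by
  obtain ⟨a1, _, c1⟩ := h1
  obtain ⟨a2, _, c2⟩ := h2
  obtain ⟨a3, _, c3⟩ := h3
  unfold HH at a1 a2 a3
  rcases a1 with ⟨h, h'⟩ | ⟨h, h'⟩ <;> rcases a2 with ⟨g, g'⟩ | ⟨g, g'⟩ <;>
    rcases a3 with ⟨f, f'⟩ | ⟨f, f'⟩
  · exact c3 ⟨_, h, g, h', g'⟩
  · exact c3 ⟨_, h, g, h', g'⟩
  · exact absurd (h.trans f) (not_lt.2 g.le)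
  · exact c1 ⟨_, g, f, g', f'⟩
  · exact c2 ⟨_, h, f, h', f'⟩
  · exact absurd (h.trans g) (not_lt.2 f.le)
  · exact c2 ⟨_, h, f, h', f'⟩
  · exact c1 ⟨_, g, f, g', f'⟩

lemma inj_subset {N : ℕ} {V : Type} [DecidableEq V] (x : V → Fin N) (S : Finset V) (a : ℕ)
    (h : a ≤ (S.image x).card) : ∃ S' ⊆ S, S'.card = a ∧ Set.InjOn x (S' : Set V) := by
  obtain ⟨S1, h1, h2, h3⟩ : ∃ S1 ⊆ S, S1.card = (S.image x).card ∧ Set.InjOn x (S1 : Set V) := by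
    obtain ⟨u, hu, hi, hb⟩ := Finset.exists_subset_injOn_image_eq_of_surjOn (f := x) S (S.image x) (by
      rw [Finset.coe_image]; exact Set.surjOn_image _ _)
    exact ⟨u, hu, by rw [← hb, Finset.card_image_of_injOn hi], hi⟩
  obtain ⟨S', h4, h5⟩ := Finset.exists_subset_card_eq (h.trans h2.ge)
  exact ⟨S', h4.trans h1, h5, h3.mono (by exact_mod_cast h4)⟩

open Classical in
lemma graph_exists {N : ℕ} {V : Type} [Fintype V] (x1 x2 : V → Fin N)
    (a k : ℕ) (ω1 ω2 : Fin N × Fin N → Bool)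
    (h1 : ¬ BadS x1 a (Cls ω2 x2) ω1) (h2 : ¬ BadS x2 a (Cls ω1 x1) ω2)
    (hS : ∀ S : Finset V, S.card = k → a ≤ (S.image x1).card ∨ a ≤ (S.image x2).card) :
    ∃ G : SimpleGraph V, G.CliqueFree 3 ∧
      ∀ S : Finset V, S.card = k → ∃ u ∈ S, ∃ v ∈ S, G.Adj u v := by
  have key : ∀ (x y : V → Fin N) (ω η : Fin N × Fin N → Bool) (S : Finset V),
      ¬ BadS x a (Cls η y) ω → a ≤ (S.image x).card → ∃ u ∈ S, ∃ v ∈ S, Edg ω η x y u v := by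
    intro x y ω η S hb ha
    obtain ⟨S', g1, g2, g3⟩ := inj_subset x S a ha
    by_contra hcon
    push Not at hcon
    refine hb ⟨S', g2, g3, fun u hu v hv huv hω => ?_⟩
    by_contra h'
    push Not at h'
    exact hcon u (g1 hu) v (g1 hv) ⟨Or.inl ⟨huv, hω⟩, h'.1, h'.2⟩
  let G : SimpleGraph V :=
    { Adj := fun u v => Edg ω1 ω2 x1 x2 u v ∨ Edg ω2 ω1 x2 x1 u v
      symm := ⟨fun u v h => h.imp Edg_symm Edg_symm⟩
      loopless := ⟨fun u h => by
        rcases h with h | h <;> exact HH_ne h.1 rfl⟩ }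
  refine ⟨G, ?_, ?_⟩
  · intro s hs
    obtain ⟨u, v, w, huv, huw, hvw, -⟩ := SimpleGraph.is3Clique_iff.1 hs
    rcases huv with a1 | a1 <;> rcases huw with a2 | a2 <;> rcases hvw with a3 | a3
    · exact Edg_mono a1 a2 a3
    · exact Edg_mix a1 a2 a3
    · exact Edg_mix (Edg_symm a1) a3 a2
    · exact Edg_mix (Edg_symm a2) (Edg_symm a3) a1
    · exact Edg_mix (Edg_symm a2) (Edg_symm a3) a1
    · exact Edg_mix (Edg_symm a1) a3 a2
    · exact Edg_mix a1 a2 a3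
    · exact Edg_mono a1 a2 a3
  · intro S hSk
    rcases hS S hSk with h | h
    · obtain ⟨u, hu, v, hv, he⟩ := key x1 x2 ω1 ω2 S h1 h
      exact ⟨u, hu, v, hv, Or.inl he⟩
    · obtain ⟨u, hu, v, hv, he⟩ := key x2 x1 ω2 ω1 S h2 h
      exact ⟨u, hu, v, hv, Or.inr he⟩
end


noncomputable section

lemma choose_le_exp (t s a : ℕ) (ht : 1 ≤ t) (hts : t ≤ 2 ^ (s ^ 2)) :
    (((t ^ 20).choose a : ℕ) : ℝ) ≤ Real.exp (20 * a * (s : ℝ) ^ 2) := by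
  have h1 : (((t ^ 20).choose a : ℕ) : ℝ) ≤ ((t : ℝ) ^ 20) ^ a := by
    exact_mod_cast Nat.choose_le_pow (t ^ 20) a
  have h2 : (t : ℝ) ≤ Real.exp ((s : ℝ) ^ 2) := by
    have h3 : (t : ℝ) ≤ 2 ^ (s ^ 2) := by exact_mod_cast hts
    have h4 : (2 : ℝ) ≤ Real.exp 1 := by linarith [Real.add_one_le_exp (1 : ℝ)]
    calc (t : ℝ) ≤ 2 ^ (s ^ 2) := h3
      _ ≤ (Real.exp 1) ^ (s ^ 2) := by gcongr
      _ = Real.exp ((s : ℝ) ^ 2) := by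
        rw [← Real.exp_nat_mul]; push_cast; ring_nf
  calc (((t ^ 20).choose a : ℕ) : ℝ) ≤ ((t : ℝ) ^ 20) ^ a := h1
    _ ≤ ((Real.exp ((s : ℝ) ^ 2)) ^ 20) ^ a := by gcongr
    _ = Real.exp (20 * a * (s : ℝ) ^ 2) := by
      rw [← pow_mul, ← Real.exp_nat_mul]; push_cast; ring_nf

lemma exp_neg_small {x : ℝ} (hx : x ≤ -100) : Real.exp x ≤ 1 / 101 := by
  have h1 : Real.exp x ≤ Real.exp (-100) := Real.exp_le_exp.2 hx
  have h2 := Real.add_one_le_exp (100 : ℝ)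
  rw [Real.exp_neg] at h1
  refine h1.trans ?_
  rw [one_div]
  apply inv_anti₀ <;> linarith

lemma half_pow_small (t s m : ℕ) (hts : t ≤ 2 ^ (s ^ 2)) (hm : 18 * s ^ 2 + 5 ≤ m) :
    (t : ℝ) ^ 18 * (1 / 2) ^ m ≤ 1 / 32 := by
  have h3 : (t : ℝ) ≤ 2 ^ (s ^ 2) := by exact_mod_cast hts
  have h4 : ((1 : ℝ) / 2) ^ m ≤ (1 / 2) ^ (18 * s ^ 2 + 5) :=
    pow_le_pow_of_le_one (by norm_num) (by norm_num) hm
  calc (t : ℝ) ^ 18 * (1 / 2) ^ m ≤ (2 ^ (s ^ 2)) ^ 18 * (1 / 2) ^ (18 * s ^ 2 + 5) := by gcongr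
    _ = ((2 : ℝ) ^ (s ^ 2)) ^ 18 * (((1 / 2) ^ (s ^ 2)) ^ 18 * (1 / 2) ^ 5) := by
      rw [← pow_mul, ← pow_mul, ← pow_add, mul_comm 18]
    _ = ((2 : ℝ) ^ (s ^ 2) * (1 / 2) ^ (s ^ 2)) ^ 18 * (1 / 2) ^ 5 := by ring
    _ = 1 / 32 := by rw [← mul_pow]; norm_num
    _ ≤ 1 / 32 := le_rfl

set_option maxHeartbeats 1600000 in
lemma good_param (t s : ℕ) (hs : 1 ≤ s) (hts : t ≤ 2 ^ (s ^ 2)) (hbig : 10 ^ 12 * s ^ 4 ≤ t)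
    (y : Fin (t ^ 18) × Fin (t ^ 2) → Fin (t ^ 18))
    (hy : ∀ b, wt y Finset.univ b ≤ ((6 * t ^ 2 : ℕ) : ℝ)) :
    Pr (mub ((s : ℝ) / (100 * t ^ 10)))
      (fun ω : Fin (t ^ 18) × Fin (t ^ 18) → Bool => ¬ Good ω y (20000 * s * t ^ 10)) ≤ 1 / 8 := by
  have hs1 : (1 : ℝ) ≤ s := by exact_mod_cast hs
  have hs4 : (s : ℝ) ≤ s ^ 4 := le_self_pow₀ hs1 (by norm_num)
  have hs24 : (s : ℝ) ^ 2 ≤ s ^ 4 := pow_le_pow_right₀ hs1 (by norm_num)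
  have hbR : (10 : ℝ) ^ 12 * s ^ 4 ≤ t := by exact_mod_cast hbig
  have hsT : (10 : ℝ) ^ 12 * s ≤ t := by linarith
  have hs2T : (10 : ℝ) ^ 12 * s ^ 2 ≤ t := by linarith
  have hT : (10 : ℝ) ^ 12 ≤ t := by linarith
  have ht1 : 1 ≤ t := by
    have : (1 : ℝ) ≤ t := by linarith
    exact_mod_cast this
  have hs0 : (0 : ℝ) < s := by linarith
  have ht0 : (0 : ℝ) < t := by linarith
  set T : ℝ := (t : ℝ) with hTdef
  set σ : ℝ := (s : ℝ) with hσ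
  set p : ℝ := σ / (100 * T ^ 10) with hp
  have hp0 : 0 < p := by positivity
  have hpT : p * T ^ 10 = σ / 100 := by rw [hp]; field_simp
  have hT10 : T ≤ T ^ 10 := le_self_pow₀ (by linarith) (by norm_num)
  have hT8 : T ≤ T ^ 8 := le_self_pow₀ (by linarith) (by norm_num)
  have hT2 : T ≤ T ^ 2 := le_self_pow₀ (by linarith) (by norm_num)
  have hp1 : p ≤ 1 := by
    rw [hp, div_le_one (by positivity)]; linarith
  set a : ℕ := 20000 * s * t ^ 10 with ha
  have haR : (a : ℝ) = 20000 * σ * T ^ 10 := by rw [ha]; push_cast; rfl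
  have hpN : p * T ^ 18 = σ * T ^ 8 / 100 := by
    calc p * T ^ 18 = (p * T ^ 10) * T ^ 8 := by ring
      _ = _ := by rw [hpT]; ring
  set Δ : ℕ := ⌈6 * (p * T ^ 18)⌉₊ with hΔ
  have hΔ1 : 6 * (p * T ^ 18) ≤ Δ := Nat.le_ceil _
  have hσT8 : T ≤ σ * T ^ 8 := by nlinarith
  have hΔ2 : (Δ : ℝ) ≤ 7 * (p * T ^ 18) := by
    have := (Nat.ceil_lt_add_one (by positivity : 0 ≤ 6 * (p * T ^ 18))).le
    rw [← hΔ] at this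
    rw [hpN] at this ⊢
    linarith
  have hΔ0 : (0 : ℝ) < Δ := lt_of_lt_of_le (by positivity) hΔ1
  have hmain := good_prob y a Δ 40 (p := p) (R := ((6 * t ^ 2 : ℕ) : ℝ)) (D := T ^ 7)
    (c := (a : ℝ) ^ 2 / 128) (l := 1 / (6 * T ^ 9)) hp0.le hp1 (by push_cast; positivity)
    (by positivity) (by positivity) hy
    (by
      push_cast
      rw [haR]
      have : 2 * (20000 * σ * T ^ 10) * (6 * T ^ 2 * 40) = (9600000 * σ) * T ^ 12 := by ring
      rw [this]
      have h2 : (T ^ 7) ^ 2 = T ^ 2 * T ^ 12 := by ring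
      rw [h2]
      gcongr
      linarith)
    (by
      push_cast
      have h1 : 6 * T ^ 2 * Δ * (2 * a) ≤ 6 * T ^ 2 * (7 * (p * T ^ 18)) * (2 * a) := by gcongr
      have h2 : 6 * T ^ 2 * (7 * (p * T ^ 18)) * (2 * a) = (84 / 2000000) * (a : ℝ) ^ 2 := by
        rw [hpN, haR]; ring
      have : (0 : ℝ) ≤ (a : ℝ) ^ 2 := by positivity
      change 4 * ((a : ℝ) ^ 2 / 128) + 6 * T ^ 2 * Δ * (2 * a) ≤ _
      linarith)
    (by
      push_cast
      have : 2 * p * a = 400 * σ ^ 2 := by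
        rw [haR]
        calc 2 * p * (20000 * σ * T ^ 10) = 40000 * σ * (p * T ^ 10) := by ring
          _ = _ := by rw [hpT]; ring
      rw [this]
      change _ ≤ 6 * T ^ 2
      linarith)
    (by
      push_cast
      change 1 / (6 * T ^ 9) * T ^ 7 * (6 * T ^ 2) ≤ 1
      apply le_of_eq
      field_simp)
  refine hmain.trans ?_
  have hN : ((t ^ 18 : ℕ) : ℝ) = T ^ 18 := by push_cast; rfl
  rw [hN]
  have t1 : T ^ 18 * (((t ^ 18).choose Δ : ℕ) * p ^ Δ) ≤ 1 / 32 := by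
    have h1 := choose_le_three (t ^ 18) Δ
    rw [hN] at h1
    have h2 : (((t ^ 18).choose Δ : ℕ) : ℝ) * p ^ Δ ≤ (1 / 2) ^ Δ := by
      calc (((t ^ 18).choose Δ : ℕ) : ℝ) * p ^ Δ ≤ (3 * T ^ 18 / Δ) ^ Δ * p ^ Δ := by gcongr
        _ = (3 * T ^ 18 / Δ * p) ^ Δ := by rw [mul_pow]
        _ ≤ (1 / 2) ^ Δ := by
          gcongr
          rw [div_mul_eq_mul_div, div_le_iff₀ hΔ0]
          linarith
    refine le_trans (mul_le_mul_of_nonneg_left h2 (by positivity)) ?_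
    apply half_pow_small t s Δ hts
    have : ((18 * s ^ 2 + 5 : ℕ) : ℝ) ≤ Δ := by
      push_cast
      rw [hpN] at hΔ1
      change 18 * σ ^ 2 + 5 ≤ _
      linarith
    exact_mod_cast this
  have t2 : (T ^ 18) ^ 2 * (T ^ 18 * p ^ 2) ^ 40 ≤ 1 / 32 := by
    have h1 : T ^ 18 * p ^ 2 ≤ 1 / T := by
      have : T ^ 18 * p ^ 2 = σ ^ 2 / (10000 * T ^ 2) := by
        rw [hp]; field_simp; norm_num
      rw [this, div_le_div_iff₀ (by positivity) ht0]
      nlinarith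
    calc (T ^ 18) ^ 2 * (T ^ 18 * p ^ 2) ^ 40 ≤ (T ^ 18) ^ 2 * (1 / T) ^ 40 := by gcongr
      _ = 1 / T ^ 4 := by field_simp
      _ ≤ 1 / 32 := by
        apply one_div_le_one_div_of_le (by norm_num)
        have : T ≤ T ^ 4 := le_self_pow₀ (by linarith) (by norm_num)
        linarith
  have t3 : ((Fintype.card (Fin (t ^ 18) × Fin (t ^ 2))).choose a : ℝ) *
        Real.exp (T ^ 18 * (1 / (6 * T ^ 9) * (21 * (p ^ 2 * a ^ 2 + p * ((6 * t ^ 2 : ℕ) : ℝ) * a)))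
          - 1 / (6 * T ^ 9) * ((a : ℝ) ^ 2 / 128)) ≤ 1 / 101 := by
    have hcard : Fintype.card (Fin (t ^ 18) × Fin (t ^ 2)) = t ^ 20 := by
      simp; ring
    rw [hcard]
    refine le_trans (mul_le_mul_of_nonneg_right (choose_le_exp t s a ht1 hts) (Real.exp_pos _).le) ?_
    rw [← Real.exp_add]
    apply exp_neg_small
    push_cast
    change 20 * (a : ℝ) * σ ^ 2 + (T ^ 18 * (1 / (6 * T ^ 9) * (21 * (p ^ 2 * a ^ 2 + p * (6 * T ^ 2) * a)))
          - 1 / (6 * T ^ 9) * ((a : ℝ) ^ 2 / 128)) ≤ -100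
    have e1 : T ^ 18 * (1 / (6 * T ^ 9) * (21 * (p ^ 2 * a ^ 2 + p * (6 * T ^ 2) * a)))
        = 1 / (6 * T ^ 9) * (21 * ((T ^ 18 * p ^ 2) * a ^ 2) + 126 * ((p * T ^ 18) * T ^ 2 * a)) := by ring
    have e2 : 126 * ((p * T ^ 18) * T ^ 2 * a) = 126 / 2000000 * (a : ℝ) ^ 2 := by
      rw [hpN, haR]; ring
    have e3 : T ^ 18 * p ^ 2 ≤ 1 / 100000 := by
      have : T ^ 18 * p ^ 2 = σ ^ 2 / (10000 * T ^ 2) := by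
        rw [hp]; field_simp; norm_num
      rw [this, div_le_div_iff₀ (by positivity) (by positivity)]
      linarith
    have ha2 : (0 : ℝ) ≤ (a : ℝ) ^ 2 := by positivity
    have e4 : 21 * ((T ^ 18 * p ^ 2) * a ^ 2) ≤ 21 / 100000 * (a : ℝ) ^ 2 := by
      nlinarith
    have e5 : 1 / (6 * T ^ 9) * (21 * ((T ^ 18 * p ^ 2) * a ^ 2) + 126 * ((p * T ^ 18) * T ^ 2 * a))
      ≤ 1 / (6 * T ^ 9) * ((a : ℝ) ^ 2 / 256) := by
      gcongr
      rw [e2]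
      linarith
    have e6 : 1 / (6 * T ^ 9) * (a : ℝ) ^ 2 = 20000 / 6 * σ * T * a := by
      have : (a : ℝ) ^ 2 = a * (20000 * σ * T ^ 10) := by rw [sq]; nth_rewrite 2 [haR]; rfl
      rw [this]; field_simp
    have ha100 : (100 : ℝ) ≤ a := by
      rw [haR]
      nlinarith
    have e7 : 21 * σ ^ 2 + 1 ≤ 10 * σ * T := by nlinarith
    have e8 : (21 * σ ^ 2 + 1) * a ≤ 10 * σ * T * a := by gcongr
    rw [e1]
    have e9 : (0 : ℝ) ≤ σ * T * a := by positivity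
    have e10 : (0 : ℝ) ≤ σ ^ 2 * a := by positivity
    nlinarith
  linarith

set_option maxHeartbeats 1600000 in
lemma main_graph (t s : ℕ) (hs : 1 ≤ s) (hts : t ≤ 2 ^ (s ^ 2)) (hbig : 10 ^ 12 * s ^ 4 ≤ t) :
    ∃ G : SimpleGraph (Fin (t ^ 18) × Fin (t ^ 2)), G.CliqueFree 3 ∧
      ∀ S : Finset (Fin (t ^ 18) × Fin (t ^ 2)), S.card = 36 * (20000 * s * t ^ 10) →
        ∃ u ∈ S, ∃ v ∈ S, G.Adj u v := by
  classical
  have hs1 : (1 : ℝ) ≤ s := by exact_mod_cast hs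
  have hs4 : (s : ℝ) ≤ s ^ 4 := le_self_pow₀ hs1 (by norm_num)
  have hs24 : (s : ℝ) ^ 2 ≤ s ^ 4 := pow_le_pow_right₀ hs1 (by norm_num)
  have hbR : (10 : ℝ) ^ 12 * s ^ 4 ≤ t := by exact_mod_cast hbig
  have hsT : (10 : ℝ) ^ 12 * s ≤ t := by linarith
  have hs2T : (10 : ℝ) ^ 12 * s ^ 2 ≤ t := by linarith
  have hT : (10 : ℝ) ^ 12 ≤ t := by linarith
  have ht1 : 1 ≤ t := by
    have : (1 : ℝ) ≤ t := by linarith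
    exact_mod_cast this
  have hs0 : (0 : ℝ) < s := by linarith
  have ht0 : (0 : ℝ) < t := by linarith
  set a : ℕ := 20000 * s * t ^ 10 with ha
  have haR : (a : ℝ) = 20000 * s * (t : ℝ) ^ 10 := by rw [ha]; push_cast; rfl
  have hT10 : (t : ℝ) ≤ (t : ℝ) ^ 10 := le_self_pow₀ (by linarith) (by norm_num)
  have hT2 : (t : ℝ) ≤ (t : ℝ) ^ 2 := le_self_pow₀ (by linarith) (by norm_num)
  have hT5 : (t : ℝ) ≤ (t : ℝ) ^ 5 := le_self_pow₀ (by linarith) (by norm_num)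
  have hT8 : (t : ℝ) ≤ (t : ℝ) ^ 8 := le_self_pow₀ (by linarith) (by norm_num)
  have ha100 : (100 : ℝ) ≤ a := by
    rw [haR]
    nlinarith
  have ha0 : (0 : ℝ) < a := by linarith
  have ha2 : 2 ≤ a := by
    have : (2 : ℝ) ≤ a := by linarith
    exact_mod_cast this
  have hcard : Fintype.card (Fin (t ^ 18) × Fin (t ^ 2)) = t ^ 20 := by
    simp; ring
  have hfib : ∀ b : Fin (t ^ 18), ((Finset.univ : Finset (Fin (t ^ 18) × Fin (t ^ 2))).filter
      fun u => u.1 = b).card ≤ t ^ 2 := by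
    intro b
    have h := Finset.card_le_card_of_injOn (s := (Finset.univ : Finset (Fin (t ^ 18) × Fin (t ^ 2))).filter
      fun u => u.1 = b) (t := (Finset.univ : Finset (Fin (t ^ 2)))) Prod.snd (fun _ _ => by simp) (by
        intro u hu v hv h
        have h1 := (Finset.mem_filter.1 hu).2
        have h2 := (Finset.mem_filter.1 hv).2
        exact Prod.ext (h1.trans h2.symm) h)
    simpa using h
  have hN : ((t ^ 18 : ℕ) : ℝ) = (t : ℝ) ^ 18 := by push_cast; rfl
  obtain ⟨x2, hx2, hS⟩ := part_exists (V := Fin (t ^ 18) × Fin (t ^ 2)) Prod.fst (t ^ 2) (6 * t ^ 2) a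
    (36 * a) hfib (by positivity)
    (by
      have : (a : ℝ) ≤ ((t ^ 18 : ℕ) : ℝ) := by
        rw [hN, haR]
        have : (t : ℝ) ^ 18 = t ^ 8 * t ^ 10 := by ring
        rw [this]
        gcongr
        linarith
      exact_mod_cast this)
    (by
      rw [hcard, hN]
      have h1 : (t : ℝ) ^ 18 * ((((t ^ 20).choose (6 * t ^ 2) : ℕ) : ℝ) * (1 / t ^ 18) ^ (6 * t ^ 2)) ≤ 1 / 32 := by
        refine le_trans (mul_le_mul_of_nonneg_left ?_ (by positivity))
          (half_pow_small t s (6 * t ^ 2) hts ?_)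
        · have h := choose_le_three (t ^ 20) (6 * t ^ 2)
          refine (mul_le_mul_of_nonneg_right h (by positivity)).trans (le_of_eq ?_)
          rw [← mul_pow]
          congr 1
          push_cast
          field_simp
          norm_num
        · have : ((18 * s ^ 2 + 5 : ℕ) : ℝ) ≤ ((6 * t ^ 2 : ℕ) : ℝ) := by
            push_cast
            linarith
          exact_mod_cast this
      have h2 : (((t ^ 18).choose a : ℕ) : ℝ) * ((((t ^ 18).choose a : ℕ) : ℝ) *
          ((((t ^ 2 * a).choose (36 * a) : ℕ) : ℝ) * ((a : ℝ) / t ^ 18) ^ (36 * a))) ≤ 1 / 4 := by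
        have h3 : (((t ^ 18).choose a : ℕ) : ℝ) ≤ ((t : ℝ) ^ 18) ^ a := by
          exact_mod_cast Nat.choose_le_pow (t ^ 18) a
        have h4 := choose_le_three (t ^ 2 * a) (36 * a)
        have h5 : 3 * ((t ^ 2 * a : ℕ) : ℝ) / ((36 * a : ℕ) : ℝ) = (t : ℝ) ^ 2 / 12 := by
          push_cast
          field_simp
          norm_num
        rw [h5] at h4
        calc _ ≤ ((t : ℝ) ^ 18) ^ a * (((t : ℝ) ^ 18) ^ a *
              (((t : ℝ) ^ 2 / 12) ^ (36 * a) * ((a : ℝ) / t ^ 18) ^ (36 * a))) := by gcongr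
          _ = ((t : ℝ) * (t ^ 2 / 12 * (a / t ^ 18))) ^ (36 * a) := by
            rw [mul_pow, mul_pow, ← mul_assoc, ← pow_mul, ← pow_add]
            congr 2
            ring
          _ ≤ (1 / 4) ^ (36 * a) := by
            gcongr
            rw [haR]
            have : (t : ℝ) * (t ^ 2 / 12 * (20000 * s * t ^ 10 / t ^ 18)) = (20000 / 12 * s) / t ^ 5 := by
              field_simp
            rw [this, div_le_div_iff₀ (by positivity) (by norm_num)]
            linarith
          _ ≤ 1 / 4 := pow_le_of_le_one (by norm_num) (by norm_num) (by omega)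
      linarith)
  have hg1 := good_param t s hs hts hbig Prod.fst (by
    intro b
    unfold wt
    have := hfib b
    have h2 : t ^ 2 ≤ 6 * t ^ 2 := by omega
    have h3 := this.trans h2
    convert (Nat.cast_le (α := ℝ)).2 h3)
  have hg2 := good_param t s hs hts hbig x2 hx2
  have hp1 : (s : ℝ) / (100 * t ^ 10) ≤ 1 := by
    rw [div_le_one (by positivity)]; linarith
  obtain ⟨ω1, ω2, h1, h2⟩ := omega_exists Prod.fst x2 a ha2 (g := 1 / 8) (by positivity) hp1 hg1 hg2 (by
    rw [hcard]
    have h3 : (((t ^ 20).choose a : ℕ) : ℝ) * Real.exp (-((s : ℝ) / (100 * t ^ 10) * a ^ 2 / 8)) ≤ 1 / 101 := by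
      refine le_trans (mul_le_mul_of_nonneg_right (choose_le_exp t s a ht1 hts) (Real.exp_pos _).le) ?_
      rw [← Real.exp_add]
      apply exp_neg_small
      have e1 : (s : ℝ) / (100 * t ^ 10) * a ^ 2 / 8 = 25 * s ^ 2 * a := by
        have : (a : ℝ) ^ 2 = a * (20000 * s * t ^ 10) := by rw [sq]; nth_rewrite 2 [haR]; rfl
        rw [this]; field_simp; norm_num
      rw [e1]
      have : (1 : ℝ) ≤ s ^ 2 := by nlinarith
      nlinarith
    linarith)
  exact graph_exists Prod.fst x2 a (36 * a) ω1 ω2 h1 h2 hS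
end


noncomputable section

lemma proper_of_clique {V α : Type*} (G : SimpleGraph V) (hG : G.CliqueFree 3) (c : V → α)
    (hc : CliqueColoring G c) {u v : V} (h : G.Adj u v) : c u ≠ c v := by
  classical
  intro he
  refine hc {u, v} ⟨?_, ?_⟩ ⟨u, by simp, v, by simp, h.ne⟩ ⟨c u, ?_⟩
  · rw [SimpleGraph.isClique_pair]
    exact fun _ => h
  · intro t ht hsub
    refine Set.Subset.antisymm ?_ hsub
    intro w hw
    by_contra hne
    simp only [Set.mem_insert_iff, Set.mem_singleton_iff, not_or] at hne
    have hu : u ∈ t := hsub (by simp)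
    have hv : v ∈ t := hsub (by simp)
    exact hG {u, v, w} (SimpleGraph.is3Clique_iff.2 ⟨u, v, w, h, ht hu hw (Ne.symm hne.1),
      ht hv hw (Ne.symm hne.2), rfl⟩)
  · intro x hx
    rcases hx with rfl | hx
    · rfl
    · rw [Set.mem_singleton_iff.1 hx, he]

lemma chi_mem {n : ℕ} (G : SimpleGraph (Fin n)) :
    ∃ c : Fin n → Fin (cliqueChromaticNumber G), CliqueColoring G c := by
  have : (cliqueChromaticNumber G) ∈ {m : ℕ | ∃ c : Fin n → Fin m, CliqueColoring G c} := by
    refine Nat.sInf_mem ⟨n, id, ?_⟩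
    rintro s _ ⟨x, hx, y, hy, hne⟩ ⟨a, ha⟩
    exact hne ((ha x hx).trans (ha y hy).symm)
  exact this

lemma chi_pos {n : ℕ} (hn : 0 < n) (G : SimpleGraph (Fin n)) : 1 ≤ cliqueChromaticNumber G := by
  obtain ⟨c, _⟩ := chi_mem G
  have := (c ⟨0, hn⟩).pos
  omega

lemma chi_lower {V : Type} [Fintype V] [DecidableEq V] (G : SimpleGraph V) (hG : G.CliqueFree 3)
    (k : ℕ) (hk : ∀ S : Finset V, S.card = k → ∃ u ∈ S, ∃ v ∈ S, G.Adj u v) (n : ℕ)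
    (hn : Fintype.card V ≤ n) :
    ∃ G' : SimpleGraph (Fin n), G'.CliqueFree 3 ∧
      Fintype.card V ≤ k * cliqueChromaticNumber G' := by
  obtain ⟨f⟩ : Nonempty (V ↪ Fin n) := Function.Embedding.nonempty_of_card_le (by simpa using hn)
  have hfree : (G.map f).CliqueFree 3 := by
    rcases isEmpty_or_nonempty V with hV | hV
    · intro S hS
      obtain ⟨u, v, w, h, -⟩ := SimpleGraph.is3Clique_iff.1 hS
      obtain ⟨u', -⟩ := (SimpleGraph.map_adj f G u v).1 h
      exact hV.elim u'
    · rw [SimpleGraph.cliqueFree_map_iff]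
      exact hG
  refine ⟨G.map f, hfree, ?_⟩
  obtain ⟨c, hc⟩ := chi_mem (G.map f)
  have h := Finset.card_le_mul_card_image_of_maps_to (f := fun u => c (f u))
    (s := (Finset.univ : Finset V)) (t := Finset.univ) (fun _ _ => Finset.mem_univ _) k (by
      intro b _
      by_contra hcon
      push Not at hcon
      obtain ⟨S, hS, hSc⟩ := Finset.exists_subset_card_eq hcon.le
      obtain ⟨u, hu, v, hv, huv⟩ := hk S hSc
      have h1 := (Finset.mem_filter.1 (hS hu)).2
      have h2 := (Finset.mem_filter.1 (hS hv)).2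
      have h3 : (G.map f).Adj (f u) (f v) := by
        rw [SimpleGraph.map_adj_apply]; exact huv
      exact proper_of_clique _ hfree c hc h3 (h1.trans h2.symm))
  simpa using h

lemma two_pow_big (L : ℕ) (hL : 60 ≤ L) : 16 * 10 ^ 12 * L ^ 2 ≤ 2 ^ L := by
  induction L, hL using Nat.le_induction with
  | base => norm_num
  | succ L hL ih =>
    have h : (L + 1) ^ 2 ≤ 2 * L ^ 2 := by nlinarith
    have h2 : 2 ^ (L + 1) = 2 * 2 ^ L := by rw [pow_succ]; ring
    omega

lemma s_exists (t : ℕ) (ht : 2 ^ 60 ≤ t) : ∃ s : ℕ, 1 ≤ s ∧ t ≤ 2 ^ (s ^ 2) ∧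
    10 ^ 12 * s ^ 4 ≤ t ∧ (s : ℝ) ^ 2 ≤ 8 * Real.log t := by
  have ht0 : t ≠ 0 := by
    rintro rfl
    norm_num at ht
  set L := Nat.log 2 t with hL
  have h1 : 2 ^ L ≤ t := Nat.pow_log_le_self 2 ht0
  have h2 : t < 2 ^ (L + 1) := Nat.lt_pow_succ_log_self (by norm_num) t
  have h60 : 60 ≤ L := by
    rw [hL]
    exact Nat.le_log_of_pow_le (by norm_num) ht
  have h3 : L < (Nat.sqrt L + 1) ^ 2 := by rw [sq]; exact Nat.lt_succ_sqrt L
  have h4 : Nat.sqrt L * Nat.sqrt L ≤ L := Nat.sqrt_le L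
  have h5 : 1 ≤ Nat.sqrt L := Nat.sqrt_pos.2 (by omega)
  have h6 : (Nat.sqrt L + 1) ^ 2 ≤ 4 * L := by nlinarith
  refine ⟨Nat.sqrt L + 1, by omega, ?_, ?_, ?_⟩
  · exact h2.le.trans (Nat.pow_le_pow_right (by norm_num) h3)
  · have : (Nat.sqrt L + 1) ^ 4 ≤ 16 * L ^ 2 := by
      calc (Nat.sqrt L + 1) ^ 4 = ((Nat.sqrt L + 1) ^ 2) ^ 2 := by ring
        _ ≤ (4 * L) ^ 2 := Nat.pow_le_pow_left h6 2
        _ = 16 * L ^ 2 := by ring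
    have h7 := two_pow_big L h60
    omega
  · have h7 : (((Nat.sqrt L + 1 : ℕ) : ℝ)) ^ 2 ≤ 4 * L := by exact_mod_cast h6
    have h8 : (L : ℝ) * Real.log 2 ≤ Real.log t := by
      rw [← Real.log_pow]
      apply Real.log_le_log (by positivity)
      exact_mod_cast h1
    have h9 := Real.log_two_gt_d9
    have : (0 : ℝ) ≤ L := by positivity
    nlinarith

lemma root_exists (n : ℕ) (hn : 1 ≤ n) : ∃ t : ℕ, 1 ≤ t ∧ t ^ 20 ≤ n ∧ n < (t + 1) ^ 20 := by
  have h1 : 1 ≤ Nat.findGreatest (fun t => t ^ 20 ≤ n) n :=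
    Nat.le_findGreatest hn (by simpa using hn)
  refine ⟨Nat.findGreatest (fun t => t ^ 20 ≤ n) n, h1, ?_, ?_⟩
  · exact Nat.findGreatest_spec (P := fun t => t ^ 20 ≤ n) (m := 1) hn (by simpa using hn)
  · by_contra hcon
    push Not at hcon
    have h2 : Nat.findGreatest (fun t => t ^ 20 ≤ n) n + 1 ≤ n :=
      (Nat.le_self_pow (by norm_num) _).trans hcon
    have := Nat.le_findGreatest (P := fun t => t ^ 20 ≤ n) h2 hcon
    omega

lemma fin_num (n t s χ Lg : ℝ) (hχ0 : 0 ≤ χ) (ht0 : 0 < t) (hs0 : 0 < s) (hlog : 1 / 2 ≤ Lg)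
    (h1 : t ^ 10 ≤ 720000 * s * χ) (h2 : n ≤ 2 ^ 20 * t ^ 20) (h3 : s ^ 2 ≤ 8 * Lg) :
    Real.sqrt (n / Lg) ≤ 2 ^ 50 * χ := by
  rw [Real.sqrt_le_left (by positivity), div_le_iff₀ (by linarith)]
  have h5 : t ^ 20 ≤ (720000 * χ) ^ 2 * s ^ 2 := by
    calc t ^ 20 = (t ^ 10) ^ 2 := by ring
      _ ≤ (720000 * s * χ) ^ 2 := by gcongr
      _ = _ := by ring
  calc n ≤ 2 ^ 20 * t ^ 20 := h2
    _ ≤ 2 ^ 20 * ((720000 * χ) ^ 2 * s ^ 2) := by gcongr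
    _ ≤ 2 ^ 20 * ((720000 * χ) ^ 2 * (8 * Lg)) := by gcongr
    _ = (2 ^ 23 * 720000 ^ 2) * χ ^ 2 * Lg := by ring
    _ ≤ (2 ^ 100) * χ ^ 2 * Lg := by
      gcongr
      norm_num
    _ = (2 ^ 50 * χ) ^ 2 * Lg := by
      rw [mul_pow, ← pow_mul]

lemma big_case (n t : ℕ) (hlog : 1 / 2 ≤ Real.log n) (ht1 : 1 ≤ t) (htn : t ^ 20 ≤ n)
    (hnt : n < (t + 1) ^ 20) (ht : 2 ^ 60 ≤ t) : ∃ G : SimpleGraph (Fin n),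
      G.CliqueFree 3 ∧
      1 / 2 ^ 50 * Real.sqrt ((n : ℝ) / Real.log n) ≤ (cliqueChromaticNumber G : ℝ) := by
  obtain ⟨s, hs, hts, hbig, hsl⟩ := s_exists t ht
  obtain ⟨G, hG, hk⟩ := main_graph t s hs hts hbig
  have hcard : Fintype.card (Fin (t ^ 18) × Fin (t ^ 2)) = t ^ 20 := by
    simp; ring
  obtain ⟨G', hG', hchi⟩ := chi_lower G hG _ hk n (by rw [hcard]; exact htn)
  refine ⟨G', hG', ?_⟩
  rw [hcard] at hchi
  have hchiR : (t : ℝ) ^ 20 ≤ 36 * (20000 * s * (t : ℝ) ^ 10) * cliqueChromaticNumber G' := by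
    have := (Nat.cast_le (α := ℝ)).2 hchi
    simpa only [Nat.cast_mul, Nat.cast_pow, Nat.cast_ofNat] using this
  set χ : ℝ := (cliqueChromaticNumber G' : ℝ) with hχ
  have hχ0 : 0 ≤ χ := Nat.cast_nonneg _
  have ht0 : (0 : ℝ) < t := by exact_mod_cast ht1
  have hs0 : (0 : ℝ) < s := by exact_mod_cast hs
  have h1 : (t : ℝ) ^ 10 ≤ 720000 * s * χ := by
    have h : (t : ℝ) ^ 10 * t ^ 10 ≤ (720000 * s * χ) * t ^ 10 := by
      calc (t : ℝ) ^ 10 * t ^ 10 = t ^ 20 := by ring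
        _ ≤ _ := hchiR
        _ = _ := by ring
    exact le_of_mul_le_mul_right h (by positivity)
  have h2 : (n : ℝ) ≤ 2 ^ 20 * t ^ 20 := by
    have : n ≤ 2 ^ 20 * t ^ 20 := by
      rw [← mul_pow]
      exact hnt.le.trans (Nat.pow_le_pow_left (by omega) 20)
    exact_mod_cast this
  have h3 : (s : ℝ) ^ 2 ≤ 8 * Real.log n := by
    have htn' : (t : ℝ) ≤ n := by
      have : t ≤ n := (Nat.le_self_pow (by norm_num) t).trans htn
      exact_mod_cast this
    have := Real.log_le_log ht0 htn'
    linarith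
  have h4 := fin_num n t s χ (Real.log n) hχ0 ht0 hs0 hlog h1 h2 h3
  rw [one_div, inv_mul_le_iff₀ (by positivity)]
  exact h4
end

/-- There exist `n`-vertex triangle-free graphs of clique chromatic number
`Ω(√(n/log n))`: the upper bound is tight. -/
theorem stmt17 :
    ∃ c : ℝ, 0 < c ∧ ∀ n : ℕ, ∃ G : SimpleGraph (Fin n),
      G.CliqueFree 3 ∧
      c * Real.sqrt ((n : ℝ) / Real.log n) ≤ (cliqueChromaticNumber G : ℝ) := by
  refine ⟨1 / 2 ^ 700, by positivity, ?_⟩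
  intro n
  rcases Nat.lt_or_ge n 2 with hn | hn
  · refine ⟨⊥, SimpleGraph.cliqueFree_bot (by norm_num), ?_⟩
    have : Real.log n = 0 := by
      interval_cases n <;> simp
    rw [this]
    simp
  have hn2 : (2 : ℝ) ≤ n := by exact_mod_cast hn
  have hlog : 1 / 2 ≤ Real.log n := by
    have h1 := Real.log_two_gt_d9
    have h2 := Real.log_le_log (by norm_num) hn2
    linarith
  obtain ⟨t, ht1, htn, hnt⟩ := root_exists n (by omega)
  rcases Nat.lt_or_ge t (2 ^ 60) with ht | ht
  · refine ⟨⊥, SimpleGraph.cliqueFree_bot (by norm_num), ?_⟩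
    have h1 : (1 : ℝ) ≤ (cliqueChromaticNumber (⊥ : SimpleGraph (Fin n)) : ℝ) := by
      exact_mod_cast chi_pos (by omega) _
    refine le_trans ?_ h1
    have h2 : n ≤ 2 ^ 1220 := by
      have : t + 1 ≤ 2 ^ 61 := by omega
      calc n ≤ (t + 1) ^ 20 := hnt.le
        _ ≤ (2 ^ 61) ^ 20 := Nat.pow_le_pow_left this 20
        _ = 2 ^ 1220 := by rw [← pow_mul]
    have h3 : (n : ℝ) ≤ 2 ^ 1220 := by exact_mod_cast h2
    have h4 : Real.sqrt ((n : ℝ) / Real.log n) ≤ 2 ^ 700 := by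
      rw [Real.sqrt_le_left (by positivity)]
      rw [div_le_iff₀ (by linarith)]
      calc (n : ℝ) ≤ 2 ^ 1220 := h3
        _ ≤ 2 ^ 1399 := pow_le_pow_right₀ (by norm_num) (by norm_num)
        _ = (2 ^ 700) ^ 2 * (1 / 2) := by
          rw [← pow_mul]
          have h5 : (2 : ℝ) ^ (700 * 2) = 2 ^ 1399 * 2 := pow_succ 2 1399
          rw [h5, mul_assoc, mul_one_div_cancel (by norm_num), mul_one]
        _ ≤ (2 ^ 700) ^ 2 * Real.log n := by gcongr
    rw [one_div, inv_mul_le_iff₀ (by positivity), mul_one]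
    exact h4
  · obtain ⟨G, hG, h⟩ := big_case n t hlog ht1 htn hnt ht
    refine ⟨G, hG, le_trans ?_ h⟩
    refine mul_le_mul_of_nonneg_right ?_ (Real.sqrt_nonneg _)
    exact one_div_le_one_div_of_le (by positivity) (pow_le_pow_right₀ (by norm_num) (by norm_num))
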